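/- arXiv:1904.08002 — 3 statements merged into one kernel-verified Lean document; each statement's English description precedes it below -/
import Mathlib

section
/- The set of quotients p/q, where p and q range over the (rational) prime numbers, is dense in the positive real numbers. -/
theorem integral_sub_mul_cos (l : ℝ) {x : ℝ} (hx : x ≠ 0) :
    ∫ t in (0 : ℝ)..l, (l - t) * Real.cos (t * x) = (1 - Real.cos (l * x)) / x ^ 2 := by
  have hderiv (t : ℝ) : HasDerivAt
      (fun t ↦ (l - t) * (Real.sin (t * x) / x) - Real.cos (t * x) / x ^ 2)
      ((l - t) * Real.cos (t * x)) t := by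
    have hmul : HasDerivAt (fun t : ℝ ↦ t * x) x t := by simpa using (hasDerivAt_id t).mul_const x
    refine ((((hasDerivAt_id t).const_sub l).mul (hmul.sin.div_const x)).sub
      (hmul.cos.div_const (x ^ 2))).congr_deriv ?_
    simp only [id]
    field_simp
    ring
  rw [intervalIntegral.integral_eq_sub_of_hasDerivAt (fun t _ ↦ hderiv t)
    (Continuous.intervalIntegrable (by fun_prop) _ _)]
  simp
  ring

theorem summable_int_one_div_one_add_sq : Summable fun k : ℤ ↦ 1 / (1 + (k : ℝ) ^ 2) := by
  have hnat : Summable fun n : ℕ ↦ 1 / (1 + (n : ℝ) ^ 2) := by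
    refine Summable.of_norm_bounded_eventually_nat
      (Real.summable_one_div_nat_pow.mpr one_lt_two) ?_
    filter_upwards [Filter.eventually_gt_atTop 0] with n hn
    rw [Real.norm_of_nonneg (by positivity)]
    gcongr
    linarith
  exact Summable.of_nat_of_neg (by simpa using hnat) (by simpa using hnat)

theorem sum_log_div_le_of_floor_eq {s : Finset ℕ} (hs : ∀ p ∈ s, p.Prime) {y : ℝ} {k : ℤ}
    (hk : ∀ p ∈ s, ⌊Real.log p - y⌋ = k) :
    ∑ p ∈ s, Real.log p / p ≤ Real.log 4 * Real.exp 1 := by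
  have hlow (p) (hp : p ∈ s) : Real.exp (y + k) ≤ p := by
    rw [← Real.le_log_iff_exp_le (mod_cast (hs p hp).pos)]
    linarith [(Int.floor_eq_iff.mp (hk p hp)).1]
  have hupp (p) (hp : p ∈ s) : (p : ℝ) ≤ Real.exp (y + k + 1) := by
    rw [← Real.log_le_iff_le_exp (mod_cast (hs p hp).pos)]
    linarith [(Int.floor_eq_iff.mp (hk p hp)).2]
  calc
    ∑ p ∈ s, Real.log p / p ≤ ∑ p ∈ s, Real.log p / Real.exp (y + k) := by
      refine Finset.sum_le_sum fun p hp ↦ ?_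
      gcongr
      exact hlow p hp
    _ = (∑ p ∈ s, Real.log p) / Real.exp (y + k) := (Finset.sum_div ..).symm
    _ ≤ Chebyshev.theta (Real.exp (y + k + 1)) / Real.exp (y + k) := by
      gcongr
      refine Finset.sum_le_sum_of_subset_of_nonneg (fun p hp ↦ ?_) fun p _ _ ↦ by positivity
      simp only [Finset.mem_filter, Finset.mem_Ioc]
      exact ⟨⟨(hs p hp).pos, Nat.le_floor (hupp p hp)⟩, hs p hp⟩
    _ ≤ Real.log 4 * Real.exp (y + k + 1) / Real.exp (y + k) := by
      gcongr
      exact Chebyshev.theta_le_log4_mul_x (Real.exp_pos _).le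
    _ = Real.log 4 * Real.exp 1 := by
      rw [Real.exp_add _ 1]
      field_simp

theorem exists_sum_log_div_mul_inv_sq_le {ε : ℝ} (hε : 0 < ε) :
    ∃ C, 0 ≤ C ∧ ∀ (y : ℝ) (s : Finset ℕ),
      (∀ p ∈ s, p.Prime ∧ ε ≤ |Real.log p - y|) →
        ∑ p ∈ s, Real.log p / p * (2 / (Real.log p - y) ^ 2) ≤ C := by
  set K : ℝ := 2 * (2 + 3 / ε ^ 2)
  set w : ℤ → ℝ := fun k ↦ 1 / (1 + (k : ℝ) ^ 2)
  set D : ℝ := Real.log 4 * Real.exp 1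
  have hD : 0 ≤ D := by positivity
  have hw (k) : 0 ≤ w k := by positivity
  refine ⟨D * K * ∑' k, w k, mul_nonneg (by positivity) (tsum_nonneg hw), fun y s hs ↦ ?_⟩
  have hpt (p) (hp : p ∈ s) : 2 / (Real.log p - y) ^ 2 ≤ K * w ⌊Real.log p - y⌋ := by
    have habs := (hs p hp).2
    set x := Real.log p - y
    have h1 := Int.floor_le x
    have h2 := Int.lt_floor_add_one x
    have hx : ε ^ 2 ≤ x ^ 2 := by rw [← sq_abs x]; gcongr
    have hx0 : 0 < x ^ 2 := by nlinarith [pow_pos hε 2]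
    have hfl : (⌊x⌋ : ℝ) ^ 2 ≤ 2 * x ^ 2 + 2 := by
      nlinarith [sq_nonneg (⌊x⌋ - 2 * x : ℝ)]
    have h3 : 3 ≤ 3 / ε ^ 2 * x ^ 2 := by
      rw [div_mul_eq_mul_div, le_div_iff₀ (by positivity)]
      linarith
    simp only [w, K]
    rw [mul_one_div, div_le_div_iff₀ hx0 (by positivity)]
    nlinarith
  calc
    ∑ p ∈ s, Real.log p / p * (2 / (Real.log p - y) ^ 2)
        ≤ ∑ p ∈ s, Real.log p / p * (K * w ⌊Real.log p - y⌋) := by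
      refine Finset.sum_le_sum fun p hp ↦ ?_
      gcongr
      exact hpt p hp
    _ = ∑ k ∈ s.image fun p : ℕ ↦ ⌊Real.log p - y⌋,
          ∑ p ∈ s with ⌊Real.log ((p : ℕ) : ℝ) - y⌋ = k, Real.log p / p * (K * w ⌊Real.log p - y⌋) :=
      (Finset.sum_fiberwise_of_maps_to (fun p hp ↦ Finset.mem_image_of_mem _ hp) _).symm
    _ ≤ ∑ k ∈ s.image fun p : ℕ ↦ ⌊Real.log p - y⌋, D * K * w k := by
      refine Finset.sum_le_sum fun k _ ↦ ?_
      calc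
        _ = ∑ p ∈ s with ⌊Real.log ((p : ℕ) : ℝ) - y⌋ = k, Real.log p / p * (K * w k) :=
          Finset.sum_congr rfl fun p hp ↦ by rw [(Finset.mem_filter.mp hp).2]
        _ = (∑ p ∈ s with ⌊Real.log ((p : ℕ) : ℝ) - y⌋ = k, Real.log p / p) * (K * w k) :=
          (Finset.sum_mul ..).symm
        _ ≤ D * (K * w k) := by
          have := hw k
          gcongr
          exact sum_log_div_le_of_floor_eq (fun p hp ↦ (hs p (Finset.mem_filter.mp hp).1).1)
            fun p hp ↦ (Finset.mem_filter.mp hp).2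
        _ = D * K * w k := (mul_assoc ..).symm
    _ = D * K * ∑ k ∈ s.image fun p : ℕ ↦ ⌊Real.log p - y⌋, w k := (Finset.mul_sum ..).symm
    _ ≤ D * K * ∑' k, w k := by
      gcongr
      exact summable_int_one_div_one_add_sq.sum_le_tsum _ fun k _ ↦ hw k

/-- The generalized trigonometric series with coefficients `a n` and frequencies `log n`. -/
noncomputable def logFreqSeries (a : ℕ → ℝ) (t : ℝ) : ℂ :=
  ∑' n, (a n : ℂ) * Complex.exp (-(t * Real.log n : ℝ) * Complex.I)

theorem norm_logFreqSeries_term (a : ℕ → ℝ) (t : ℝ) (n : ℕ) :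
    ‖(a n : ℂ) * Complex.exp (-(t * Real.log n : ℝ) * Complex.I)‖ = |a n| := by
  rw [norm_mul, ← Complex.ofReal_neg, Complex.norm_exp_ofReal_mul_I, mul_one, Complex.norm_real,
    Real.norm_eq_abs]

theorem continuous_logFreqSeries {a : ℕ → ℝ} (ha : Summable a) : Continuous (logFreqSeries a) :=
  continuous_tsum (fun n ↦ by fun_prop) ha.abs fun n t ↦ (norm_logFreqSeries_term a t n).le

theorem hasSum_mul_cos_logFreqSeries {a : ℕ → ℝ} (ha : Summable a) (c t : ℝ) :
    HasSum (fun z : ℕ × ℕ ↦ a z.1 * a z.2 * Real.cos (t * (Real.log z.1 - Real.log z.2 - c)))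
      (Real.cos (t * c) * ‖logFreqSeries a t‖ ^ 2) := by
  have hnorm : Summable fun n ↦ ‖(a n : ℂ) * Complex.exp (-(t * Real.log n : ℝ) * Complex.I)‖ := by
    simpa only [norm_logFreqSeries_term] using ha.abs
  have hsum : HasSum (fun n ↦ (a n : ℂ) * Complex.exp (-(t * Real.log n : ℝ) * Complex.I))
      (logFreqSeries a t) := hnorm.of_norm.hasSum
  have hconj := Complex.hasSum_conj'.mpr hsum
  have hmul := summable_mul_of_summable_norm
    (g := fun n ↦ (starRingEnd ℂ) ((a n : ℂ) * Complex.exp (-(t * Real.log n : ℝ) * Complex.I)))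
    hnorm (by simpa only [RCLike.norm_conj] using hnorm)
  have hprod := (hsum.mul hconj hmul).mul_left (Complex.exp ((t * c : ℝ) * Complex.I))
  have hre := Complex.hasSum_re hprod
  rw [Complex.mul_conj, Complex.re_mul_ofReal, Complex.exp_ofReal_mul_I_re,
    Complex.normSq_eq_norm_sq] at hre
  refine hre.congr_fun fun z ↦ ?_
  have hterm : Complex.exp ((t * c : ℝ) * Complex.I) *
      ((a z.1 : ℂ) * Complex.exp (-(t * Real.log z.1 : ℝ) * Complex.I) *
        ((a z.2 : ℂ) * Complex.exp (-(t * Real.log z.2 : ℝ) * -Complex.I))) =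
      ((a z.1 * a z.2 : ℝ) : ℂ) *
        Complex.exp ((-(t * (Real.log z.1 - Real.log z.2 - c)) : ℝ) * Complex.I) := by
    rw [mul_mul_mul_comm, mul_left_comm, ← Complex.exp_add, ← Complex.exp_add]
    push_cast
    ring_nf
  simp only [map_mul, ← Complex.exp_conj, Complex.conj_ofReal, Complex.conj_I, map_neg]
  rw [hterm, Complex.re_ofReal_mul, Complex.exp_ofReal_mul_I_re, Real.cos_neg]

theorem hasSum_integral_logFreqSeries {a : ℕ → ℝ} (ha : Summable a) (c l : ℝ) :
    HasSum (fun z : ℕ × ℕ ↦ a z.1 * a z.2 *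
        ∫ t in (0 : ℝ)..l, (l - t) * Real.cos (t * (Real.log z.1 - Real.log z.2 - c)))
      (∫ t in (0 : ℝ)..l, (l - t) * (Real.cos (t * c) * ‖logFreqSeries a t‖ ^ 2)) := by
  have hab : Summable fun z : ℕ × ℕ ↦ |a z.1 * a z.2| :=
    (summable_mul_of_summable_norm (f := a) (g := a) ha.abs ha.abs).abs
  simp_rw [← intervalIntegral.integral_const_mul]
  refine intervalIntegral.hasSum_integral_of_dominated_convergence
    (fun z t ↦ |l - t| * |a z.1 * a z.2|)
    (fun z ↦ Continuous.aestronglyMeasurable (by fun_prop)) ?_ ?_ ?_ ?_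
  · refine fun z ↦ .of_forall fun t _ ↦ ?_
    rw [Real.norm_eq_abs, abs_mul, abs_mul (l - t), mul_comm]
    gcongr
    exact mul_le_of_le_one_right (abs_nonneg _) (Real.abs_cos_le_one _)
  · exact .of_forall fun t _ ↦ hab.mul_left _
  · simp_rw [tsum_mul_left]
    exact Continuous.intervalIntegrable (by fun_prop) _ _
  · refine .of_forall fun t _ ↦ ?_
    convert! (hasSum_mul_cos_logFreqSeries ha c t).mul_left (l - t) using 2 with z
    ring

theorem le_integral_logFreqSeries {a : ℕ → ℝ} (ha : Summable a) {c l δ η M : ℝ}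
    (hη : 0 < η) (hηδ : η ≤ δ) (hηM : 4 * M * η ≤ 1) (hδl : 2 * δ ≤ l)
    (hcos : ∀ t ∈ Set.Icc 0 δ, 1 / 2 ≤ Real.cos (t * c))
    (hbd : ∀ t ∈ Set.Icc 0 l, ‖logFreqSeries a t - 1 / (η + t * Complex.I)‖ ≤ M) :
    l / (64 * η) - l ^ 2 * (1 / δ + M) ^ 2 ≤
      ∫ t in (0 : ℝ)..l, (l - t) * (Real.cos (t * c) * ‖logFreqSeries a t‖ ^ 2) := by
  have hcont := continuous_logFreqSeries ha
  have hint (u v : ℝ) : IntervalIntegrable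
      (fun t ↦ (l - t) * (Real.cos (t * c) * ‖logFreqSeries a t‖ ^ 2)) MeasureTheory.volume u v :=
    Continuous.intervalIntegrable (by fun_prop) _ _
  have hηl : η ≤ l := by linarith
  rw [← intervalIntegral.integral_add_adjacent_intervals (hint 0 η) (hint η l)]
  have hnear : l / (64 * η) ≤
      ∫ t in (0 : ℝ)..η, (l - t) * (Real.cos (t * c) * ‖logFreqSeries a t‖ ^ 2) := by
    calc
      l / (64 * η) = ∫ t in (0 : ℝ)..η, l / 2 * (1 / 2 * (1 / (4 * η)) ^ 2) := by
        rw [intervalIntegral.integral_const, smul_eq_mul]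
        field_simp
        ring
      _ ≤ _ := by
        refine intervalIntegral.integral_mono_on hη.le (by simp) (hint _ _) fun t ht ↦ ?_
        have hpole : 1 / (2 * η) ≤ ‖1 / (η + t * Complex.I : ℂ)‖ := by
          rw [norm_div, norm_one]
          refine one_div_le_one_div_of_le ?_ ?_
          · rw [norm_pos_iff]
            intro h
            simpa [hη.ne'] using congrArg Complex.re h
          · refine (norm_add_le _ _).trans ?_
            rw [norm_mul, Complex.norm_I, Complex.norm_real, Complex.norm_real,
              Real.norm_of_nonneg hη.le, Real.norm_of_nonneg ht.1]
            linarith [ht.2]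
        have hM' : M ≤ 1 / (4 * η) := by
          rw [le_div_iff₀ (by positivity)]
          linarith
        have hnorm : 1 / (4 * η) ≤ ‖logFreqSeries a t‖ := by
          have h1 := hbd t ⟨ht.1, ht.2.trans hηl⟩
          have h2 := norm_sub_norm_le (1 / (η + t * Complex.I : ℂ)) (logFreqSeries a t)
          rw [norm_sub_rev] at h2
          have h3 : 1 / (2 * η) = 1 / (4 * η) + 1 / (4 * η) := by field_simp; norm_num
          linarith
        have h4 := hcos t ⟨ht.1, ht.2.trans hηδ⟩
        have h5 : l / 2 ≤ l - t := by linarith [ht.2]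
        have h6 : 0 ≤ l - t := by linarith
        gcongr
  have hfar : -(l ^ 2 * (1 / δ + M) ^ 2) ≤
      ∫ t in η..l, (l - t) * (Real.cos (t * c) * ‖logFreqSeries a t‖ ^ 2) := by
    calc
      -(l ^ 2 * (1 / δ + M) ^ 2) ≤ ∫ t in η..l, -(l * (1 / δ + M) ^ 2) := by
        rw [intervalIntegral.integral_const, smul_eq_mul]
        have : 0 ≤ η * (l * (1 / δ + M) ^ 2) :=
          mul_nonneg hη.le (mul_nonneg (by linarith) (sq_nonneg _))
        nlinarith
      _ ≤ _ := by
        refine intervalIntegral.integral_mono_on hηl (by simp) (hint _ _) fun t ht ↦ ?_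
        have ht0 : 0 < t := hη.trans_le ht.1
        have hlt : 0 ≤ l - t := by linarith [ht.2]
        rcases le_total t δ with htδ | htδ
        · have h1 := hcos t ⟨ht0.le, htδ⟩
          have h2 : 0 ≤ (l - t) * (Real.cos (t * c) * ‖logFreqSeries a t‖ ^ 2) :=
            mul_nonneg hlt (mul_nonneg (by linarith) (sq_nonneg _))
          have h3 : 0 ≤ l * (1 / δ + M) ^ 2 := mul_nonneg (by linarith) (sq_nonneg _)
          linarith
        · have hpole : ‖1 / (η + t * Complex.I : ℂ)‖ ≤ 1 / δ := by
            rw [norm_div, norm_one]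
            refine one_div_le_one_div_of_le (hη.trans_le hηδ) ?_
            refine htδ.trans ?_
            simpa [abs_of_pos ht0] using Complex.abs_im_le_norm (η + t * Complex.I : ℂ)
          have hnorm : ‖logFreqSeries a t‖ ≤ 1 / δ + M := by
            have h1 := hbd t ⟨ht0.le, ht.2⟩
            have h2 := norm_sub_norm_le (logFreqSeries a t) (1 / (η + t * Complex.I : ℂ))
            linarith
          have h3 : ‖logFreqSeries a t‖ ^ 2 ≤ (1 / δ + M) ^ 2 := by gcongr
          have h4 : -(1 / δ + M) ^ 2 ≤ Real.cos (t * c) * ‖logFreqSeries a t‖ ^ 2 := by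
            nlinarith [Real.neg_one_le_cos (t * c), sq_nonneg ‖logFreqSeries a t‖]
          nlinarith [sq_nonneg (1 / δ + M)]
  linarith

/-- The coefficients of the Dirichlet series `∑ log p / p ^ (1 + η)` over the primes `p`. -/
noncomputable def primeLogCoeff (η : ℝ) (n : ℕ) : ℝ :=
  (if n.Prime then Real.log n else 0) / (n : ℝ) ^ (1 + η)

theorem primeLogCoeff_nonneg (η : ℝ) (n : ℕ) : 0 ≤ primeLogCoeff η n := by
  unfold primeLogCoeff
  split_ifs <;> positivity

theorem prime_of_primeLogCoeff_ne_zero {η : ℝ} {n : ℕ} (h : primeLogCoeff η n ≠ 0) :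
    n.Prime := by
  by_contra hn
  simp [primeLogCoeff, hn] at h

theorem primeLogCoeff_le {η : ℝ} (hη : 0 ≤ η) {p : ℕ} (hp : p.Prime) :
    primeLogCoeff η p ≤ Real.log p / p := by
  rw [primeLogCoeff, if_pos hp]
  gcongr
  · exact mod_cast hp.pos
  · exact Real.self_le_rpow_of_one_le (mod_cast hp.one_le) (by linarith)

theorem ofReal_div_rpow_mul_exp {b : ℝ} {η t : ℝ} {n : ℕ} (hn : n ≠ 0) :
    ((b / (n : ℝ) ^ (1 + η) : ℝ) : ℂ) * Complex.exp (-(t * Real.log n : ℝ) * Complex.I) =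
      LSeries.term (fun _ ↦ (b : ℂ)) (1 + η + t * Complex.I) n := by
  have hn' : (n : ℂ) ≠ 0 := mod_cast hn
  rw [LSeries.term_of_ne_zero hn, Complex.ofReal_div, Complex.ofReal_cpow n.cast_nonneg,
    Complex.ofReal_natCast, Complex.cpow_add (1 + η : ℂ) _ hn',
    Complex.cpow_def_of_ne_zero hn' (t * Complex.I), div_mul_eq_div_mul_one_div,
    ← div_eq_mul_one_div, div_eq_mul_inv, div_eq_mul_inv, ← Complex.exp_neg]
  rw [← Complex.natCast_log]
  push_cast
  ring_nf

open ArithmeticFunction in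
theorem summable_vonMangoldt_div_rpow {η : ℝ} (hη : 0 < η) :
    Summable fun n : ℕ ↦ vonMangoldt n / (n : ℝ) ^ (1 + η) := by
  have h := LSeriesSummable_vonMangoldt (s := ((1 + η : ℝ) : ℂ)) (by simpa using hη)
  refine h.norm.congr fun n ↦ ?_
  rcases eq_or_ne n 0 with rfl | hn
  · simp
  · rw [LSeries.norm_term_eq, if_neg hn, Complex.ofReal_re, Complex.norm_real,
      Real.norm_of_nonneg vonMangoldt_nonneg]

theorem summable_primeLogCoeff {η : ℝ} (hη : 0 < η) : Summable (primeLogCoeff η) := by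
  refine (summable_vonMangoldt_div_rpow hη).of_nonneg_of_le (primeLogCoeff_nonneg η) fun n ↦ ?_
  unfold primeLogCoeff
  gcongr
  split_ifs with hn
  · rw [ArithmeticFunction.vonMangoldt_apply_prime hn]
  · exact ArithmeticFunction.vonMangoldt_nonneg

open ArithmeticFunction in
theorem residueClass_one_eq_vonMangoldt (n : ℕ) :
    vonMangoldt.residueClass (1 : ZMod 1) n = vonMangoldt n :=
  Set.indicator_of_mem (show n ∈ {n : ℕ | (n : ZMod 1) = 1} from Subsingleton.elim _ _) _

open ArithmeticFunction in
theorem exists_norm_LSeries_vonMangoldt_sub_le (l : ℝ) :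
    ∃ M, ∀ η ∈ Set.Ioc (0 : ℝ) 1, ∀ t ∈ Set.Icc 0 l,
      ‖LSeries (fun n ↦ (vonMangoldt n : ℂ)) (1 + η + t * Complex.I) - 1 / (η + t * Complex.I)‖
        ≤ M := by
  have hcompact : IsCompact (Set.Icc (1 : ℝ) 2 ×ℂ Set.Icc 0 l) :=
    isCompact_Icc.reProdIm isCompact_Icc
  obtain ⟨M, hM⟩ := hcompact.exists_bound_of_continuousOn
    ((vonMangoldt.continuousOn_LFunctionResidueClassAux (q := 1) 1).mono fun s hs ↦ hs.1.1)
  refine ⟨M, fun η hη t ht ↦ ?_⟩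
  have h := hM (1 + η + t * Complex.I) (by
    rw [Complex.mem_reProdIm]
    simp only [Complex.add_re, Complex.one_re, Complex.ofReal_re, Complex.re_ofReal_mul,
      Complex.I_re, Complex.add_im, Complex.one_im, Complex.ofReal_im, Complex.im_ofReal_mul,
      Complex.I_im, Set.mem_Icc]
    refine ⟨⟨?_, ?_⟩, ?_, ?_⟩ <;> linarith [hη.1, hη.2, ht.1, ht.2])
  rw [vonMangoldt.eqOn_LFunctionResidueClassAux isUnit_one (by simpa using hη.1)] at h
  simpa only [residueClass_one_eq_vonMangoldt, Nat.totient_one, Nat.cast_one, inv_one, add_assoc,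
    add_sub_cancel_left] using h

theorem exists_norm_logFreqSeries_primeLogCoeff_sub_le (l : ℝ) :
    ∃ M, 0 ≤ M ∧ ∀ η ∈ Set.Ioc (0 : ℝ) 1, ∀ t ∈ Set.Icc 0 l,
      ‖logFreqSeries (primeLogCoeff η) t - 1 / (η + t * Complex.I)‖ ≤ M := by
  obtain ⟨M, hM⟩ := exists_norm_LSeries_vonMangoldt_sub_le l
  have hnp := ArithmeticFunction.vonMangoldt.summable_residueClass_non_primes_div (1 : ZMod 1)
  simp only [residueClass_one_eq_vonMangoldt] at hnp
  set N := ∑' n : ℕ, (if n.Prime then 0 else ArithmeticFunction.vonMangoldt n) / (n : ℝ)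
  refine ⟨max 0 (M + N), le_max_left .., fun η hη t ht ↦ le_max_of_le_right ?_⟩
  have hre : 1 < (1 + η + t * Complex.I : ℂ).re := by simpa using hη.1
  have hL := (ArithmeticFunction.LSeriesSummable_vonMangoldt hre).hasSum
  have hp : Summable fun n ↦
      (primeLogCoeff η n : ℂ) * Complex.exp (-(t * Real.log n : ℝ) * Complex.I) :=
    Summable.of_norm (by
      simpa only [norm_logFreqSeries_term] using (summable_primeLogCoeff hη.1).abs)
  have hbound (n : ℕ) :
      ‖LSeries.term (fun n ↦ (ArithmeticFunction.vonMangoldt n : ℂ)) (1 + η + t * Complex.I) n -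
        (primeLogCoeff η n : ℂ) * Complex.exp (-(t * Real.log n : ℝ) * Complex.I)‖ ≤
      (if n.Prime then 0 else ArithmeticFunction.vonMangoldt n) / (n : ℝ) := by
    rcases eq_or_ne n 0 with rfl | hn
    · simp [primeLogCoeff]
    · have hterm := ofReal_div_rpow_mul_exp
        (b := if n.Prime then Real.log n else 0) (η := η) (t := t) hn
      rw [primeLogCoeff, hterm, LSeries.term_of_ne_zero hn, LSeries.term_of_ne_zero hn]
      split_ifs with hprime
      · simp [ArithmeticFunction.vonMangoldt_apply_prime hprime]
      · rw [Complex.ofReal_zero, zero_div, sub_zero, norm_div, Complex.norm_real,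
          Real.norm_of_nonneg ArithmeticFunction.vonMangoldt_nonneg,
          Complex.norm_natCast_cpow_of_pos (Nat.pos_of_ne_zero hn)]
        have : (0 : ℝ) < n := mod_cast Nat.pos_of_ne_zero hn
        have := ArithmeticFunction.vonMangoldt_nonneg (n := n)
        gcongr
        exact Real.self_le_rpow_of_one_le (mod_cast Nat.one_le_iff_ne_zero.mpr hn) hre.le
  have hdiff : ‖LSeries (fun n ↦ (ArithmeticFunction.vonMangoldt n : ℂ)) (1 + η + t * Complex.I) -
      logFreqSeries (primeLogCoeff η) t‖ ≤ N := by
    rw [logFreqSeries, LSeries, ← hL.summable.tsum_sub hp]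
    exact tsum_of_norm_bounded hnp.hasSum hbound
  calc
    _ ≤ ‖logFreqSeries (primeLogCoeff η) t -
          LSeries (fun n ↦ (ArithmeticFunction.vonMangoldt n : ℂ)) (1 + η + t * Complex.I)‖ +
        ‖LSeries (fun n ↦ (ArithmeticFunction.vonMangoldt n : ℂ)) (1 + η + t * Complex.I) -
          1 / (η + t * Complex.I)‖ := norm_sub_le_norm_sub_add_norm_sub ..
    _ ≤ M + N := by
      rw [norm_sub_rev]
      linarith [hM η hη t ht]

theorem exists_primes_abs_log_sub_log_sub_lt (c : ℝ) {ε : ℝ} (hε : 0 < ε) :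
    ∃ p q : ℕ, p.Prime ∧ q.Prime ∧ |Real.log p - Real.log q - c| < ε := by
  by_contra! hgap
  obtain ⟨C, hC, hshell⟩ := exists_sum_log_div_mul_inv_sq_le hε
  obtain ⟨δ, hδ, hδ1, hcos⟩ : ∃ δ > 0, δ ≤ 1 ∧ ∀ t ∈ Set.Icc 0 δ, 1 / 2 ≤ Real.cos (t * c) := by
    refine ⟨1 / (1 + |c|), by positivity, ?_, fun t ht ↦ ?_⟩
    · rw [div_le_one (by positivity)]
      linarith [abs_nonneg c]
    · have htc : |t * c| ≤ 1 := by
        rw [abs_mul, abs_of_nonneg ht.1]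
        have := ht.2
        rw [le_div_iff₀ (by positivity)] at this
        nlinarith [ht.1]
      have := Real.one_sub_sq_div_two_le_cos (x := t * c)
      have : (t * c) ^ 2 ≤ 1 := (sq_le_one_iff_abs_le_one _).mpr htc
      linarith
  set l : ℝ := 64 * (C + 1)
  obtain ⟨M, hM, hpole⟩ := exists_norm_logFreqSeries_primeLogCoeff_sub_le l
  set E : ℝ := C * M + l ^ 2 * (1 / δ + M) ^ 2 + 4 * M
  have hE : 0 ≤ E := by positivity
  have hupper {η : ℝ} (hη : η ∈ Set.Ioc 0 1) :
      ∫ t in (0 : ℝ)..l, (l - t) * (Real.cos (t * c) * ‖logFreqSeries (primeLogCoeff η) t‖ ^ 2) ≤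
        C * (1 / η + M) := by
    have ha := summable_primeLogCoeff hη.1
    have ha0 := primeLogCoeff_nonneg η
    have htotal : ∑' n, primeLogCoeff η n ≤ 1 / η + M := by
      have h := hpole η hη 0 ⟨le_rfl, by positivity⟩
      have hzero : logFreqSeries (primeLogCoeff η) 0 = (∑' n, primeLogCoeff η n : ℝ) := by
        simp [logFreqSeries, Complex.ofReal_tsum]
      rw [hzero, Complex.ofReal_zero, zero_mul, add_zero, ← Complex.ofReal_one,
        ← Complex.ofReal_div, ← Complex.ofReal_sub, Complex.norm_real] at h
      linarith [(abs_le.mp h).2]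
    let g : ℕ × ℕ → ℝ := fun z ↦ primeLogCoeff η z.1 * primeLogCoeff η z.2 *
      (2 / (Real.log z.1 - Real.log z.2 - c) ^ 2)
    have hg0 (z) : 0 ≤ g z := mul_nonneg (mul_nonneg (ha0 _) (ha0 _)) (by positivity)
    refine hasSum_le_of_sum_le (hasSum_integral_logFreqSeries ha c l) fun s ↦ ?_
    calc
      _ ≤ ∑ z ∈ s, g z := by
        refine Finset.sum_le_sum fun z _ ↦ ?_
        by_cases hz : primeLogCoeff η z.1 * primeLogCoeff η z.2 = 0
        · simp [g, hz]
        · have hp := prime_of_primeLogCoeff_ne_zero (left_ne_zero_of_mul hz)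
          have hq := prime_of_primeLogCoeff_ne_zero (right_ne_zero_of_mul hz)
          have hne := abs_pos.mp (hε.trans_le (hgap _ _ hp hq))
          rw [integral_sub_mul_cos l hne]
          refine mul_le_mul_of_nonneg_left ?_ (mul_nonneg (ha0 _) (ha0 _))
          gcongr
          linarith [Real.neg_one_le_cos (l * (Real.log z.1 - Real.log z.2 - c))]
      _ ≤ ∑ z ∈ s.image Prod.fst ×ˢ s.image Prod.snd, g z :=
        Finset.sum_le_sum_of_subset_of_nonneg Finset.subset_product fun z _ _ ↦ hg0 z
      _ = ∑ q ∈ s.image Prod.snd, ∑ p ∈ s.image Prod.fst, g (p, q) := Finset.sum_product_right ..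
      _ ≤ ∑ q ∈ s.image Prod.snd, C * primeLogCoeff η q := by
        refine Finset.sum_le_sum fun q _ ↦ ?_
        by_cases hq0 : primeLogCoeff η q = 0
        · simp [g, hq0]
        have hq := prime_of_primeLogCoeff_ne_zero hq0
        calc
          _ = ∑ p ∈ (s.image Prod.fst).filter Nat.Prime, g (p, q) := by
            refine (Finset.sum_filter_of_ne fun p _ hp ↦ ?_).symm
            exact prime_of_primeLogCoeff_ne_zero
              (left_ne_zero_of_mul (left_ne_zero_of_mul hp))
          _ ≤ ∑ p ∈ (s.image Prod.fst).filter Nat.Prime, primeLogCoeff η q *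
                (Real.log p / p * (2 / (Real.log p - (Real.log q + c)) ^ 2)) := by
            refine Finset.sum_le_sum fun p hp ↦ ?_
            simp only [g]
            rw [mul_comm (primeLogCoeff η p), mul_assoc, sub_sub]
            have h1 := primeLogCoeff_le hη.1.le (Finset.mem_filter.mp hp).2
            have h2 := ha0 q
            gcongr
          _ = primeLogCoeff η q * ∑ p ∈ (s.image Prod.fst).filter Nat.Prime,
                Real.log p / p * (2 / (Real.log p - (Real.log q + c)) ^ 2) :=
            (Finset.mul_sum ..).symm
          _ ≤ primeLogCoeff η q * C := by
            refine mul_le_mul_of_nonneg_left (hshell _ _ fun p hp ↦ ?_) (ha0 q)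
            have hp' := (Finset.mem_filter.mp hp).2
            exact ⟨hp', by simpa only [sub_sub] using hgap p q hp' hq⟩
          _ = _ := mul_comm ..
      _ = C * ∑ q ∈ s.image Prod.snd, primeLogCoeff η q := (Finset.mul_sum ..).symm
      _ ≤ C * ∑' q, primeLogCoeff η q := by
        gcongr
        exact ha.sum_le_tsum _ fun q _ ↦ ha0 q
      _ ≤ C * (1 / η + M) := by gcongr
  set η : ℝ := δ / (2 + E)
  have hη0 : 0 < η := by positivity
  have hηE : η * (2 + E) = δ := div_mul_cancel₀ _ (by positivity)
  have hηδ : η ≤ δ := by nlinarith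
  have hηE' : η * E < 1 := by nlinarith
  have hη : η ∈ Set.Ioc 0 1 := ⟨hη0, hηδ.trans hδ1⟩
  have hEM : 4 * M ≤ E := by
    have : 0 ≤ C * M + l ^ 2 * (1 / δ + M) ^ 2 := by positivity
    linarith
  have hlower := le_integral_logFreqSeries (summable_primeLogCoeff hη0) hη0 hηδ
    (by nlinarith) (by simp only [l]; linarith) hcos (hpole η hη)
  have hcontr := hlower.trans (hupper hη)
  have hl : l / (64 * η) = C / η + 1 / η := by
    simp only [l]
    field_simp
  have hCη : C * (1 / η + M) = C / η + C * M := by ring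
  have hlt : E < 1 / η := by
    rw [lt_div_iff₀ hη0]
    linarith
  simp only [E] at hlt
  linarith

theorem quotients_of_primes_dense_in_pos_reals :
    ∀ x : ℝ, 0 < x → x ∈ closure {r : ℝ | ∃ p q : ℕ, p.Prime ∧ q.Prime ∧ r = (p : ℝ) / q} := by
  intro x hx
  refine Metric.mem_closure_iff.mpr fun ε hε ↦ ?_
  obtain ⟨δ, hδ, hexp⟩ := Metric.continuous_iff.mp Real.continuous_exp (Real.log x) ε hε
  obtain ⟨p, q, hp, hq, hpq⟩ := exists_primes_abs_log_sub_log_sub_lt (Real.log x) hδ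
  refine ⟨p / q, ⟨p, q, hp, hq, rfl⟩, ?_⟩
  have hp0 : (0 : ℝ) < p := mod_cast hp.pos
  have hq0 : (0 : ℝ) < q := mod_cast hq.pos
  have h := hexp (Real.log p - Real.log q) hpq
  rwa [Real.exp_sub, Real.exp_log hp0, Real.exp_log hq0, Real.exp_log hx, dist_comm] at h
end

section
/- For every positive integer n, the number of Hurwitz quaternions of norm n equals 24 times the sum of the odd divisors of n. -/
noncomputable def qNorm (a : Quaternion ℝ) : ℝ :=
  a.re ^ 2 + a.imI ^ 2 + a.imJ ^ 2 + a.imK ^ 2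

def IsHurwitz (a : Quaternion ℝ) : Prop :=
  (∃ x₁ x₂ x₃ x₄ : ℤ, a = ⟨(x₁ : ℝ), x₂, x₃, x₄⟩) ∨
  (∃ x₁ x₂ x₃ x₄ : ℤ, a = ⟨(x₁ : ℝ) + 1/2, (x₂ : ℝ) + 1/2, (x₃ : ℝ) + 1/2, (x₄ : ℝ) + 1/2⟩)

def IsHurwitzPrime (p : Quaternion ℝ) : Prop :=
  IsHurwitz p ∧ ∃ r : ℕ, r.Prime ∧ qNorm p = r

open Finset

/-- The integer solutions of `x² + y² + z² + w² = M`. -/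
noncomputable def sumFourSqReps (M : ℤ) : Finset (ℤ × ℤ × ℤ × ℤ) :=
  (Icc (-M) M ×ˢ Icc (-M) M ×ˢ Icc (-M) M ×ˢ Icc (-M) M).filter
    fun x => x.1 ^ 2 + x.2.1 ^ 2 + x.2.2.1 ^ 2 + x.2.2.2 ^ 2 = M

/-- The solutions of `x² + y² + z² + w² = M` in odd integers. -/
noncomputable def oddSumFourSqReps (M : ℤ) : Finset (ℤ × ℤ × ℤ × ℤ) :=
  (sumFourSqReps M).filter fun x => Odd x.1 ∧ Odd x.2.1 ∧ Odd x.2.2.1 ∧ Odd x.2.2.2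

/-- The solutions of `v² + x² + y² + z² + w² = N` in odd integers. -/
noncomputable def oddSumFiveSqReps (N : ℤ) : Finset (ℤ × ℤ × ℤ × ℤ × ℤ) :=
  (Icc (-N) N ×ˢ Icc (-N) N ×ˢ Icc (-N) N ×ˢ Icc (-N) N ×ˢ Icc (-N) N).filter
    fun x => (Odd x.1 ∧ Odd x.2.1 ∧ Odd x.2.2.1 ∧ Odd x.2.2.2.1 ∧ Odd x.2.2.2.2) ∧
      x.1 ^ 2 + x.2.1 ^ 2 + x.2.2.1 ^ 2 + x.2.2.2.1 ^ 2 + x.2.2.2.2 ^ 2 = N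

/-- The solutions of `4ab = M` in positive integers. -/
noncomputable def fourMulPairs (M : ℤ) : Finset (ℤ × ℤ) :=
  (Icc 1 M ×ˢ Icc 1 M).filter fun x => 4 * (x.1 * x.2) = M

/-- The solutions of `j² + 4ab = N` with `a` and `b` positive. -/
noncomputable def sqAddFourMulTriples (N : ℤ) : Finset (ℤ × ℤ × ℤ) :=
  (Icc (-N) N ×ˢ Icc 1 N ×ˢ Icc 1 N).filter fun x => x.1 ^ 2 + 4 * (x.2.1 * x.2.2) = N

theorem mem_Icc_of_sq_le {x M : ℤ} (h : x ^ 2 ≤ M) : x ∈ Icc (-M) M := by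
  rw [mem_Icc]
  constructor <;> nlinarith [Int.le_self_sq x, Int.le_self_sq (-x)]

theorem mem_sumFourSqReps {M x y z w : ℤ} :
    (x, y, z, w) ∈ sumFourSqReps M ↔ x ^ 2 + y ^ 2 + z ^ 2 + w ^ 2 = M := by
  simp only [sumFourSqReps, mem_filter, mem_product, and_iff_right_iff_imp]
  intro h
  refine ⟨?_, ?_, ?_, ?_⟩ <;> apply mem_Icc_of_sq_le <;>
    nlinarith [sq_nonneg x, sq_nonneg y, sq_nonneg z, sq_nonneg w]

theorem mem_oddSumFourSqReps {M x y z w : ℤ} :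
    (x, y, z, w) ∈ oddSumFourSqReps M ↔
      x ^ 2 + y ^ 2 + z ^ 2 + w ^ 2 = M ∧ Odd x ∧ Odd y ∧ Odd z ∧ Odd w := by
  rw [oddSumFourSqReps, mem_filter, mem_sumFourSqReps]

theorem mem_oddSumFiveSqReps {N v x y z w : ℤ} :
    (v, x, y, z, w) ∈ oddSumFiveSqReps N ↔ (Odd v ∧ Odd x ∧ Odd y ∧ Odd z ∧ Odd w) ∧
      v ^ 2 + x ^ 2 + y ^ 2 + z ^ 2 + w ^ 2 = N := by
  simp only [oddSumFiveSqReps, mem_filter, mem_product, and_iff_right_iff_imp]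
  rintro ⟨-, h⟩
  refine ⟨?_, ?_, ?_, ?_, ?_⟩ <;> apply mem_Icc_of_sq_le <;>
    nlinarith [sq_nonneg v, sq_nonneg x, sq_nonneg y, sq_nonneg z, sq_nonneg w]

theorem mem_fourMulPairs {M a b : ℤ} :
    (a, b) ∈ fourMulPairs M ↔ 0 < a ∧ 0 < b ∧ 4 * (a * b) = M := by
  simp only [fourMulPairs, mem_filter, mem_product, mem_Icc]
  constructor
  · rintro ⟨⟨⟨ha, -⟩, hb, -⟩, h⟩
    exact ⟨ha, hb, h⟩
  · rintro ⟨ha, hb, h⟩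
    exact ⟨⟨⟨ha, by nlinarith⟩, hb, by nlinarith⟩, h⟩

theorem mem_sqAddFourMulTriples {N j a b : ℤ} :
    (j, a, b) ∈ sqAddFourMulTriples N ↔ 0 < a ∧ 0 < b ∧ j ^ 2 + 4 * (a * b) = N := by
  simp only [sqAddFourMulTriples, mem_filter, mem_product]
  constructor
  · rintro ⟨⟨-, ha, hb⟩, h⟩
    exact ⟨(mem_Icc.1 ha).1, (mem_Icc.1 hb).1, h⟩
  · rintro ⟨ha, hb, h⟩
    have hab := mul_pos ha hb
    refine ⟨⟨mem_Icc_of_sq_le (by linarith), mem_Icc.2 ⟨ha, ?_⟩, mem_Icc.2 ⟨hb, ?_⟩⟩, h⟩ <;>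
      nlinarith [sq_nonneg j]

/-- The five coordinates contribute equally to `∑ (v² + x² + y² + z² + w²)`. -/
theorem sum_oddSumFiveSqReps (N : ℤ) : ∑ x ∈ oddSumFiveSqReps N, (N - 5 * x.1 ^ 2) = 0 := by
  have h1 : ∑ x ∈ oddSumFiveSqReps N, x.2.1 ^ 2 = ∑ x ∈ oddSumFiveSqReps N, x.1 ^ 2 := by
    refine sum_nbij' (fun x => (x.2.1, x.1, x.2.2.1, x.2.2.2.1, x.2.2.2.2))
      (fun x => (x.2.1, x.1, x.2.2.1, x.2.2.2.1, x.2.2.2.2)) ?_ ?_ ?_ ?_ ?_ <;>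
    rintro ⟨v, x, y, z, w⟩ <;> simp only [mem_oddSumFiveSqReps] <;> grind
  have h2 : ∑ x ∈ oddSumFiveSqReps N, x.2.2.1 ^ 2 = ∑ x ∈ oddSumFiveSqReps N, x.1 ^ 2 := by
    refine sum_nbij' (fun x => (x.2.2.1, x.2.1, x.1, x.2.2.2.1, x.2.2.2.2))
      (fun x => (x.2.2.1, x.2.1, x.1, x.2.2.2.1, x.2.2.2.2)) ?_ ?_ ?_ ?_ ?_ <;>
    rintro ⟨v, x, y, z, w⟩ <;> simp only [mem_oddSumFiveSqReps] <;> grind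
  have h3 : ∑ x ∈ oddSumFiveSqReps N, x.2.2.2.1 ^ 2 = ∑ x ∈ oddSumFiveSqReps N, x.1 ^ 2 := by
    refine sum_nbij' (fun x => (x.2.2.2.1, x.2.1, x.2.2.1, x.1, x.2.2.2.2))
      (fun x => (x.2.2.2.1, x.2.1, x.2.2.1, x.1, x.2.2.2.2)) ?_ ?_ ?_ ?_ ?_ <;>
    rintro ⟨v, x, y, z, w⟩ <;> simp only [mem_oddSumFiveSqReps] <;> grind
  have h4 : ∑ x ∈ oddSumFiveSqReps N, x.2.2.2.2 ^ 2 = ∑ x ∈ oddSumFiveSqReps N, x.1 ^ 2 := by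
    refine sum_nbij' (fun x => (x.2.2.2.2, x.2.1, x.2.2.1, x.2.2.2.1, x.1))
      (fun x => (x.2.2.2.2, x.2.1, x.2.2.1, x.2.2.2.1, x.1)) ?_ ?_ ?_ ?_ ?_ <;>
    rintro ⟨v, x, y, z, w⟩ <;> simp only [mem_oddSumFiveSqReps] <;> grind
  have hN : ∑ x ∈ oddSumFiveSqReps N, N = ∑ x ∈ oddSumFiveSqReps N,
      (x.1 ^ 2 + x.2.1 ^ 2 + x.2.2.1 ^ 2 + x.2.2.2.1 ^ 2 + x.2.2.2.2 ^ 2) := by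
    refine sum_congr rfl ?_
    rintro ⟨v, x, y, z, w⟩ h
    exact (mem_oddSumFiveSqReps.1 h).2.symm
  rw [sum_sub_distrib, hN, ← mul_sum]
  simp only [sum_add_distrib, h1, h2, h3, h4]
  ring

theorem sum_mul_card_oddSumFourSqReps (N : ℤ) :
    ∑ j ∈ (Icc (-N) N).filter (fun j => Odd j),
      (N - 5 * j ^ 2) * #(oddSumFourSqReps (N - j ^ 2)) = 0 := by
  rw [← sum_oddSumFiveSqReps N, sum_finset_product (oddSumFiveSqReps N)
    ((Icc (-N) N).filter (fun j => Odd j)) (fun j => oddSumFourSqReps (N - j ^ 2))]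
  · refine sum_congr rfl fun j _ => ?_
    simp only [sum_const, nsmul_eq_mul, mul_comm]
  · rintro ⟨v, x, y, z, w⟩
    rw [mem_oddSumFiveSqReps, mem_filter, mem_oddSumFourSqReps]
    constructor
    · rintro ⟨⟨hv, ho⟩, h⟩
      refine ⟨⟨mem_Icc_of_sq_le ?_, hv⟩, by linarith, ho⟩
      dsimp only
      nlinarith [sq_nonneg x, sq_nonneg y, sq_nonneg z, sq_nonneg w]
    · rintro ⟨⟨-, hv⟩, h, ho⟩
      exact ⟨⟨hv, ho⟩, by linarith⟩

/-- A Zagier-type involution on the forms `ax² + jxy - by²` of discriminant `N`. -/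
def zagierInvolution (x : ℤ × ℤ × ℤ) : ℤ × ℤ × ℤ :=
  if x.2.1 + x.1 < x.2.2 then (-x.1 - 2 * x.2.1, x.2.1, x.2.2 - x.2.1 - x.1)
  else (2 * x.2.2 - x.1, x.2.1 + x.1 - x.2.2, x.2.2)

theorem sum_sqAddFourMulTriples_eq_zero {N : ℤ} (hN : ¬ IsSquare N) :
    ∑ x ∈ sqAddFourMulTriples N, ((x.2.1 + x.2.2) * (x.2.1 * x.2.2 - x.1 ^ 2)
      - x.1 * (x.2.1 ^ 2 - x.2.2 ^ 2)) = 0 := by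
  have hne {j a b : ℤ} (h : j ^ 2 + 4 * (a * b) = N) : a + j ≠ b := by
    rintro rfl
    exact hN ⟨j + 2 * a, by rw [← h]; ring⟩
  refine sum_involution (fun x _ => zagierInvolution x) ?_ ?_ ?_ ?_
  · rintro ⟨j, a, b⟩ -
    simp only [zagierInvolution]
    split_ifs <;> ring
  · rintro ⟨j, a, b⟩ hx h0 h
    rw [mem_sqAddFourMulTriples] at hx
    simp only [zagierInvolution] at h
    apply h0
    split_ifs at h with hlt <;> simp only [Prod.mk.injEq] at h
    · obtain rfl : j = -a := by linarith
      ring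
    · obtain rfl : j = b := by linarith
      ring
  · rintro ⟨j, a, b⟩ hx
    rw [mem_sqAddFourMulTriples] at hx
    have := hne hx.2.2
    simp only [zagierInvolution]
    split_ifs with hlt <;> rw [mem_sqAddFourMulTriples]
    · exact ⟨hx.1, by linarith, by linarith [hx.2.2]⟩
    · exact ⟨by omega, hx.2.1, by linarith [hx.2.2]⟩
  · rintro ⟨j, a, b⟩ hx
    rw [mem_sqAddFourMulTriples] at hx
    have := hne hx.2.2
    simp only [zagierInvolution]
    split_ifs <;> dsimp only at * <;>
      simp only [Prod.mk.injEq, true_and, and_true] <;> omega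

theorem sum_sqAddFourMulTriples {N : ℤ} (hN : ¬ IsSquare N) :
    ∑ x ∈ sqAddFourMulTriples N, (x.2.1 * x.2.2 - x.1 ^ 2) * x.2.1 = 0 := by
  have hodd : ∑ x ∈ sqAddFourMulTriples N, x.1 * (x.2.1 ^ 2 - x.2.2 ^ 2) = 0 := by
    have : ∑ x ∈ sqAddFourMulTriples N, x.1 * (x.2.1 ^ 2 - x.2.2 ^ 2)
        = ∑ x ∈ sqAddFourMulTriples N, -(x.1 * (x.2.1 ^ 2 - x.2.2 ^ 2)) := by
      refine sum_nbij' (fun x => (-x.1, x.2)) (fun x => (-x.1, x.2)) ?_ ?_ ?_ ?_ ?_ <;>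
      rintro ⟨j, a, b⟩ <;> simp [mem_sqAddFourMulTriples]
    rw [sum_neg_distrib] at this
    linarith
  have hswap : ∑ x ∈ sqAddFourMulTriples N, (x.2.1 * x.2.2 - x.1 ^ 2) * x.2.1
      = ∑ x ∈ sqAddFourMulTriples N, (x.2.1 * x.2.2 - x.1 ^ 2) * x.2.2 := by
    refine sum_nbij' (fun x => (x.1, x.2.2, x.2.1)) (fun x => (x.1, x.2.2, x.2.1))
      ?_ ?_ ?_ ?_ ?_ <;>
    rintro ⟨j, a, b⟩ <;> simp only [mem_sqAddFourMulTriples] <;> grind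
  have h := sum_sqAddFourMulTriples_eq_zero hN
  rw [sum_sub_distrib, hodd, sub_zero] at h
  simp only [add_mul, sum_add_distrib] at h
  simp only [mul_comm _ (_ - _)] at h
  linarith

theorem Int.sq_emod_eight_of_odd {x : ℤ} (hx : Odd x) : x ^ 2 % 8 = 1 := by
  obtain ⟨k, rfl⟩ := hx
  obtain ⟨m, hm⟩ := Int.even_mul_succ_self k
  have : (2 * k + 1) ^ 2 = 8 * m + 1 := by linear_combination 4 * hm
  omega

theorem not_isSquare_of_emod_eight {N : ℤ} (hN : N % 8 = 5) : ¬ IsSquare N := by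
  rintro ⟨r, rfl⟩
  have hr : Odd r := by
    by_contra h
    obtain ⟨k, rfl⟩ := Int.not_odd_iff_even.1 h
    ring_nf at hN
    omega
  have := Int.sq_emod_eight_of_odd hr
  rw [sq] at this
  omega

theorem sum_mul_sum_fourMulPairs {N : ℤ} (hN : N % 8 = 5) :
    ∑ j ∈ (Icc (-N) N).filter (fun j => Odd j),
      (N - 5 * j ^ 2) * ∑ x ∈ fourMulPairs (N - j ^ 2), x.1 = 0 := by
  have h := sum_sqAddFourMulTriples (not_isSquare_of_emod_eight hN)
  rw [sum_finset_product (sqAddFourMulTriples N)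
    ((Icc (-N) N).filter (fun j => Odd j)) (fun j => fourMulPairs (N - j ^ 2))] at h
  · rw [← mul_zero 4, ← h, mul_sum]
    refine sum_congr rfl fun j _ => ?_
    rw [mul_sum, mul_sum]
    refine sum_congr rfl ?_
    rintro ⟨a, b⟩ hab
    have := (mem_fourMulPairs.1 hab).2.2
    dsimp only
    linear_combination -a * this
  · rintro ⟨j, a, b⟩
    rw [mem_sqAddFourMulTriples, mem_filter, mem_fourMulPairs]
    constructor
    · rintro ⟨ha, hb, h⟩
      refine ⟨⟨mem_Icc_of_sq_le (by dsimp only; nlinarith [mul_pos ha hb]), ?_⟩,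
        ha, hb, by linarith⟩
      have : Odd (j ^ 2) := by rw [Int.odd_iff]; omega
      exact (Int.odd_pow' two_ne_zero).1 this
    · rintro ⟨-, ha, hb, h⟩
      exact ⟨ha, hb, by linarith⟩

theorem card_oddSumFourSqReps {M : ℕ} (hM : M % 8 = 4) :
    (#(oddSumFourSqReps M) : ℤ) = 16 * ∑ x ∈ fourMulPairs M, x.1 := by
  induction M using Nat.strong_induction_on with
  | _ M ih =>
  rcases eq_or_ne M 4 with rfl | hM4
  · decide +kernel
  have hsub : ∑ j ∈ (Icc (-(M + 1 : ℤ)) (M + 1)).filter (fun j => Odd j),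
      ((M + 1 : ℤ) - 5 * j ^ 2) * (#(oddSumFourSqReps (M + 1 - j ^ 2)) -
        16 * ∑ x ∈ fourMulPairs (M + 1 - j ^ 2), x.1) = 0 := by
    have h1 := sum_mul_card_oddSumFourSqReps (M + 1)
    have h2 := sum_mul_sum_fourMulPairs (N := M + 1) (by omega)
    simp only [mul_sub, sum_sub_distrib, h1, mul_left_comm _ (16 : ℤ), ← mul_sum, h2]
    simp
  rw [← sum_subset (s₁ := {1, -1})] at hsub
  · rw [sum_pair (by decide)] at hsub
    norm_num at hsub
    have hc : (M + 1 : ℤ) - 5 ≠ 0 := by omega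
    have := hsub.resolve_left hc
    linarith
  · intro j hj
    simp only [mem_insert, mem_singleton] at hj
    rw [mem_filter, mem_Icc]
    rcases hj with rfl | rfl <;> exact ⟨by omega, by decide⟩
  · intro j hj hj1
    have ho := (mem_filter.1 hj).2
    have h8 := Int.sq_emod_eight_of_odd ho
    have hgt : 1 < j ^ 2 := by
      simp only [mem_insert, mem_singleton, not_or] at hj1
      obtain ⟨k, rfl⟩ := ho
      have : k ≤ -2 ∨ 1 ≤ k := by omega
      rcases this with h | h <;> nlinarith
    rcases le_or_gt ((M : ℤ) + 1 - j ^ 2) 0 with hle | hpos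
    · have e1 : oddSumFourSqReps (M + 1 - j ^ 2) = ∅ := by
        rw [eq_empty_iff_forall_notMem]
        rintro ⟨x, y, z, w⟩ h
        obtain ⟨h, hx, -⟩ := mem_oddSumFourSqReps.1 h
        have : 0 < x ^ 2 := by
          have := Int.sq_emod_eight_of_odd hx
          have := sq_nonneg x
          omega
        nlinarith [sq_nonneg y, sq_nonneg z, sq_nonneg w]
      have e2 : fourMulPairs (M + 1 - j ^ 2) = ∅ := by
        rw [eq_empty_iff_forall_notMem]
        rintro ⟨a, b⟩ h
        obtain ⟨ha, hb, h⟩ := mem_fourMulPairs.1 h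
        nlinarith [mul_pos ha hb]
      simp [e1, e2]
    · obtain ⟨m, hm⟩ := Int.eq_ofNat_of_zero_le hpos.le
      rw [hm, ih m (by omega) (by omega), sub_self, mul_zero]

theorem sum_fourMulPairs (n : ℕ) :
    ∑ x ∈ fourMulPairs (4 * n), x.1 = ((∑ d ∈ n.divisors, d : ℕ) : ℤ) := by
  rw [← Nat.sum_divisorsAntidiagonal (fun d _ => d), Nat.cast_sum]
  refine sum_nbij' (fun x => (x.1.toNat, x.2.toNat)) (fun x => (x.1, x.2)) ?_ ?_ ?_ ?_ ?_
  · rintro ⟨a, b⟩ h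
    obtain ⟨ha, hb, h⟩ := mem_fourMulPairs.1 h
    lift a to ℕ using ha.le
    lift b to ℕ using hb.le
    rw [Nat.mem_divisorsAntidiagonal]
    norm_cast at *
    have : a * b = n := by omega
    exact ⟨this, this ▸ (Nat.mul_pos ha hb).ne'⟩
  · rintro ⟨a, b⟩ h
    obtain ⟨h, h0⟩ := Nat.mem_divisorsAntidiagonal.1 h
    subst h
    rw [mem_fourMulPairs]
    have := Nat.mul_ne_zero_iff.1 h0
    refine ⟨by dsimp only; omega, by dsimp only; omega, by push_cast; ring⟩
  · rintro ⟨a, b⟩ h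
    obtain ⟨ha, hb, h⟩ := mem_fourMulPairs.1 h
    simp [ha.le, hb.le]
  · rintro ⟨a, b⟩ -
    simp
  · rintro ⟨a, b⟩ h
    simp [(mem_fourMulPairs.1 h).1.le]

theorem card_oddSumFourSqReps_four_mul {n : ℕ} (hn : Odd n) :
    #(oddSumFourSqReps (4 * n)) = 16 * ∑ d ∈ n.divisors, d := by
  have h := card_oddSumFourSqReps (M := 4 * n) (by obtain ⟨k, rfl⟩ := hn; omega)
  push_cast at h
  rw [sum_fourMulPairs] at h
  exact_mod_cast h

/-- The Hadamard transform identifies the integral solutions of norm `n` with the odd solutions of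
norm `4n` whose coordinate sum is divisible by `4`. -/
theorem card_filter_four_dvd_oddSumFourSqReps {n : ℤ} (hn : Odd n) :
    #((oddSumFourSqReps (4 * n)).filter
      fun x => 4 ∣ x.1 + x.2.1 + x.2.2.1 + x.2.2.2) = #(sumFourSqReps n) := by
  symm
  refine card_nbij' (fun x => (x.1 + x.2.1 + x.2.2.1 + x.2.2.2, x.1 + x.2.1 - x.2.2.1 - x.2.2.2,
      x.1 - x.2.1 + x.2.2.1 - x.2.2.2, x.1 - x.2.1 - x.2.2.1 + x.2.2.2))
    (fun x => ((x.1 + x.2.1 + x.2.2.1 + x.2.2.2) / 4, (x.1 + x.2.1 - x.2.2.1 - x.2.2.2) / 4,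
      (x.1 - x.2.1 + x.2.2.1 - x.2.2.2) / 4, (x.1 - x.2.1 - x.2.2.1 + x.2.2.2) / 4)) ?_ ?_ ?_ ?_
  · rintro ⟨x, y, z, w⟩ h
    simp only [mem_coe, mem_sumFourSqReps, mem_filter, mem_oddSumFourSqReps] at *
    have hs : Odd (x + y + z + w) := by
      rw [← h] at hn
      simpa [Int.odd_add, Int.even_add, Int.odd_pow, Int.even_pow, parity_simps] using hn
    rw [Int.odd_iff] at hs
    refine ⟨⟨by rw [← h]; ring, ?_, ?_, ?_, ?_⟩, by omega⟩ <;> rw [Int.odd_iff] <;> omega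
  · rintro ⟨x, y, z, w⟩ h
    simp only [mem_coe, mem_sumFourSqReps, mem_filter, mem_oddSumFourSqReps, Int.odd_iff] at *
    obtain ⟨⟨h, hx, hy, hz, hw⟩, hd⟩ := h
    obtain ⟨p, hp⟩ : 4 ∣ x + y + z + w := hd
    obtain ⟨q, hq⟩ : 4 ∣ x + y - z - w := by omega
    obtain ⟨r, hr⟩ : 4 ∣ x - y + z - w := by omega
    obtain ⟨s, hs⟩ : 4 ∣ x - y - z + w := by omega
    rw [hp, hq, hr, hs]
    simp only [Int.mul_ediv_cancel_left _ (show (4 : ℤ) ≠ 0 by decide)]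
    obtain rfl : x = p + q + r + s := by linarith
    obtain rfl : y = p + q - r - s := by linarith
    obtain rfl : z = p - q + r - s := by linarith
    obtain rfl : w = p - q - r + s := by linarith
    linarith
  · rintro ⟨x, y, z, w⟩ -
    simp only [Prod.mk.injEq]
    omega
  · rintro ⟨x, y, z, w⟩ h
    simp only [mem_coe, mem_filter, mem_oddSumFourSqReps, Int.odd_iff] at h
    simp only [Prod.mk.injEq]
    omega

/-- Changing the sign of one coordinate of an odd solution changes the coordinate sum modulo `4`. -/
theorem card_oddSumFourSqReps_eq_two_mul {n : ℤ} (hn : Odd n) :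
    #(oddSumFourSqReps (4 * n)) = 2 * #(sumFourSqReps n) := by
  rw [← card_filter_four_dvd_oddSumFourSqReps hn, two_mul,
    ← card_filter_add_card_filter_not (s := oddSumFourSqReps (4 * n))
      (fun x => 4 ∣ x.1 + x.2.1 + x.2.2.1 + x.2.2.2), add_right_inj]
  refine card_nbij' (fun x => (-x.1, x.2)) (fun x => (-x.1, x.2)) ?_ ?_ ?_ ?_ <;>
    rintro ⟨x, y, z, w⟩ <;>
    simp only [mem_coe, mem_filter, mem_oddSumFourSqReps, Int.odd_iff, neg_neg, neg_sq,
      implies_true] <;>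
    omega

/-- The doubles of the Hurwitz quaternions of norm `n`, in coordinates. -/
noncomputable def doubledHurwitz (n : ℤ) : Finset (ℤ × ℤ × ℤ × ℤ) :=
  (sumFourSqReps (4 * n)).filter
    fun x => x.1 % 2 = x.2.1 % 2 ∧ x.1 % 2 = x.2.2.1 % 2 ∧ x.1 % 2 = x.2.2.2 % 2

theorem mem_doubledHurwitz {n x y z w : ℤ} :
    (x, y, z, w) ∈ doubledHurwitz n ↔ x ^ 2 + y ^ 2 + z ^ 2 + w ^ 2 = 4 * n ∧
      x % 2 = y % 2 ∧ x % 2 = z % 2 ∧ x % 2 = w % 2 := by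
  rw [doubledHurwitz, mem_filter, mem_sumFourSqReps]

theorem card_doubledHurwitz (n : ℤ) :
    #(doubledHurwitz n) = #(oddSumFourSqReps (4 * n)) + #(sumFourSqReps n) := by
  rw [← card_filter_add_card_filter_not (s := doubledHurwitz n) (fun x => Odd x.1)]
  congr 1
  · congr 1
    ext ⟨x, y, z, w⟩
    simp only [mem_filter, mem_doubledHurwitz, mem_oddSumFourSqReps, Int.odd_iff]
    omega
  · refine card_nbij' (fun x => (x.1 / 2, x.2.1 / 2, x.2.2.1 / 2, x.2.2.2 / 2))
      (fun x => (2 * x.1, 2 * x.2.1, 2 * x.2.2.1, 2 * x.2.2.2)) ?_ ?_ ?_ ?_ <;>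
      rintro ⟨x, y, z, w⟩ h <;>
      simp only [mem_coe, mem_filter, mem_doubledHurwitz, mem_sumFourSqReps, Int.odd_iff,
        Prod.mk.injEq] at *
    · obtain ⟨p, rfl⟩ : 2 ∣ x := by omega
      obtain ⟨q, rfl⟩ : 2 ∣ y := by omega
      obtain ⟨r, rfl⟩ : 2 ∣ z := by omega
      obtain ⟨s, rfl⟩ : 2 ∣ w := by omega
      simp only [Int.mul_ediv_cancel_left _ (show (2 : ℤ) ≠ 0 by decide)]
      linarith [h.1.1]
    · exact ⟨⟨by rw [← h]; ring, by omega⟩, by omega⟩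
    · omega
    · omega

/-- Multiplication by `1 + i` identifies the Hurwitz quaternions of norm `n` with those of
norm `2n`. -/
theorem card_doubledHurwitz_two_mul (n : ℤ) :
    #(doubledHurwitz (2 * n)) = #(doubledHurwitz n) := by
  symm
  refine card_nbij' (fun x => (x.1 - x.2.1, x.1 + x.2.1, x.2.2.1 - x.2.2.2, x.2.2.1 + x.2.2.2))
    (fun x => ((x.1 + x.2.1) / 2, (x.2.1 - x.1) / 2, (x.2.2.1 + x.2.2.2) / 2,
      (x.2.2.2 - x.2.2.1) / 2)) ?_ ?_ ?_ ?_ <;>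
    rintro ⟨x, y, z, w⟩ h <;>
    simp only [mem_coe, mem_doubledHurwitz, Prod.mk.injEq] at *
  · exact ⟨by linarith [h.1], by omega⟩
  · obtain ⟨h, hp⟩ := h
    have hx : x % 2 = 0 := by
      by_contra hx
      have e1 := Int.sq_emod_eight_of_odd (x := x) (by rw [Int.odd_iff]; omega)
      have e2 := Int.sq_emod_eight_of_odd (x := y) (by rw [Int.odd_iff]; omega)
      have e3 := Int.sq_emod_eight_of_odd (x := z) (by rw [Int.odd_iff]; omega)
      have e4 := Int.sq_emod_eight_of_odd (x := w) (by rw [Int.odd_iff]; omega)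
      omega
    obtain ⟨p, rfl⟩ : 2 ∣ x := by omega
    obtain ⟨q, rfl⟩ : 2 ∣ y := by omega
    obtain ⟨r, rfl⟩ : 2 ∣ z := by omega
    obtain ⟨s, rfl⟩ : 2 ∣ w := by omega
    have hs : Even (p + q + r + s) := by
      have : Even (p ^ 2 + q ^ 2 + r ^ 2 + s ^ 2) := ⟨n, by linarith⟩
      simpa [parity_simps] using this
    rw [Int.even_iff] at hs
    simp only [← mul_add, ← mul_sub, Int.mul_ediv_cancel_left _ (show (2 : ℤ) ≠ 0 by decide)]
    exact ⟨by linarith, by omega⟩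
  · omega
  · omega

theorem card_doubledHurwitz_of_odd {n : ℕ} (hn : Odd n) :
    #(doubledHurwitz n) = 24 * ∑ d ∈ n.divisors, d := by
  have h1 := card_oddSumFourSqReps_four_mul hn
  have h2 := card_oddSumFourSqReps_eq_two_mul (n := n) (by exact_mod_cast hn)
  rw [card_doubledHurwitz]
  omega

theorem card_doubledHurwitz_eq (n : ℕ) (hn : 0 < n) :
    #(doubledHurwitz n) = 24 * ∑ d ∈ n.divisors.filter (fun d => ¬ 2 ∣ d), d := by
  induction n using Nat.strong_induction_on with
  | _ n ih =>
  rcases Nat.even_or_odd' n with ⟨m, rfl | rfl⟩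
  · have hdiv : (2 * m).divisors.filter (fun d => ¬ 2 ∣ d)
        = m.divisors.filter (fun d => ¬ 2 ∣ d) := by
      ext d
      simp only [mem_filter, Nat.mem_divisors]
      constructor
      · rintro ⟨⟨hd, -⟩, h2⟩
        have : Nat.Coprime d 2 := (Nat.prime_two.coprime_iff_not_dvd.2 h2).symm
        exact ⟨⟨this.dvd_of_dvd_mul_left hd, by omega⟩, h2⟩
      · rintro ⟨⟨hd, -⟩, h2⟩
        exact ⟨⟨hd.mul_left 2, by omega⟩, h2⟩
    rw [hdiv, Nat.cast_mul, Nat.cast_ofNat, card_doubledHurwitz_two_mul,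
      ih m (by omega) (by omega)]
  · rw [card_doubledHurwitz_of_odd ⟨m, rfl⟩, filter_true_of_mem]
    intro d hd h2
    have := h2.trans (Nat.dvd_of_mem_divisors hd)
    omega

/-- The quaternion `(x + yi + zj + wk) / 2`. -/
noncomputable def halfQuaternion (x : ℤ × ℤ × ℤ × ℤ) : Quaternion ℝ :=
  ⟨(x.1 : ℝ) / 2, (x.2.1 : ℝ) / 2, (x.2.2.1 : ℝ) / 2, (x.2.2.2 : ℝ) / 2⟩

theorem halfQuaternion_injective : Function.Injective halfQuaternion := by
  rintro ⟨x, y, z, w⟩ ⟨x', y', z', w'⟩ h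
  obtain ⟨hx, hy, hz, hw⟩ := Quaternion.ext_iff.1 h
  simp only [halfQuaternion, div_left_inj' (two_ne_zero' ℝ), Int.cast_inj] at hx hy hz hw
  rw [hx, hy, hz, hw]

theorem setOf_isHurwitz_eq_image (n : ℕ) :
    {a : Quaternion ℝ | IsHurwitz a ∧ qNorm a = n} =
      halfQuaternion '' (doubledHurwitz n : Set (ℤ × ℤ × ℤ × ℤ)) := by
  ext a
  simp only [Set.mem_ofPred_eq, Set.mem_image, mem_coe]
  constructor
  · rintro ⟨⟨p, q, r, s, rfl⟩ | ⟨p, q, r, s, rfl⟩, h⟩ <;> simp only [qNorm] at h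
    · refine ⟨(2 * p, 2 * q, 2 * r, 2 * s), mem_doubledHurwitz.2 ⟨?_, by omega⟩, ?_⟩
      · have : p ^ 2 + q ^ 2 + r ^ 2 + s ^ 2 = (n : ℤ) := by exact_mod_cast h
        linarith
      · ext <;> simp only [halfQuaternion] <;> push_cast <;> ring
    · refine ⟨(2 * p + 1, 2 * q + 1, 2 * r + 1, 2 * s + 1),
        mem_doubledHurwitz.2 ⟨?_, by omega⟩, ?_⟩
      · have : (((2 * p + 1) ^ 2 + (2 * q + 1) ^ 2 + (2 * r + 1) ^ 2 + (2 * s + 1) ^ 2 : ℤ) : ℝ)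
            = (4 * n : ℤ) := by
          push_cast
          linarith
        exact_mod_cast this
      · ext <;> simp only [halfQuaternion] <;> push_cast <;> ring
  · rintro ⟨⟨x, y, z, w⟩, hx, rfl⟩
    obtain ⟨h, hp⟩ := mem_doubledHurwitz.1 hx
    refine ⟨?_, ?_⟩
    · rcases Int.even_or_odd' x with ⟨p, rfl | rfl⟩
      · obtain ⟨q, rfl⟩ : 2 ∣ y := by omega
        obtain ⟨r, rfl⟩ : 2 ∣ z := by omega
        obtain ⟨s, rfl⟩ : 2 ∣ w := by omega
        refine Or.inl ⟨p, q, r, s, ?_⟩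
        ext <;> simp only [halfQuaternion] <;> push_cast <;> ring
      · obtain ⟨q, rfl⟩ : ∃ q, y = 2 * q + 1 := ⟨y / 2, by omega⟩
        obtain ⟨r, rfl⟩ : ∃ r, z = 2 * r + 1 := ⟨z / 2, by omega⟩
        obtain ⟨s, rfl⟩ : ∃ s, w = 2 * s + 1 := ⟨w / 2, by omega⟩
        refine Or.inr ⟨p, q, r, s, ?_⟩
        ext <;> simp only [halfQuaternion] <;> push_cast <;> ring
    · have : (x : ℝ) ^ 2 + y ^ 2 + z ^ 2 + w ^ 2 = 4 * n := by exact_mod_cast h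
      simp only [qNorm, halfQuaternion]
      linarith

theorem hurwitz_count_of_norm (n : ℕ) (hn : 0 < n) :
    {a : Quaternion ℝ | IsHurwitz a ∧ qNorm a = n}.ncard
      = 24 * ∑ d ∈ n.divisors.filter (fun d => ¬ 2 ∣ d), d := by
  rw [setOf_isHurwitz_eq_image, Set.ncard_image_of_injective _ halfQuaternion_injective,
    Set.ncard_coe_finset, card_doubledHurwitz_eq n hn]
end

section
/- Jacobi's four-square theorem: for a positive integer n, the number of integer solutions (x₁,x₂,x₃,x₄) of x₁² + x₂² + x₃² + x₄² = n equals 8 times the sum of divisors of n if n is odd, and 24 times the sum of the odd divisors of n if n is even. -/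
noncomputable def fourSquareReps (n : ℕ) : ℕ :=
  {v : Fin 4 → ℤ | v 0 ^ 2 + v 1 ^ 2 + v 2 ^ 2 + v 3 ^ 2 = (n : ℤ)}.ncard

/-- The positive solutions in `d`, `e` of `i ^ 2 + d * e = n`, as triples `(i, d, e)`. -/
noncomputable def squareAddMul (n : ℤ) : Finset (ℤ × ℤ × ℤ) :=
  (Finset.Icc (-n) n ×ˢ Finset.Icc 1 n ×ˢ Finset.Icc 1 n).filter
    fun p => p.1 ^ 2 + p.2.1 * p.2.2 = n

theorem mem_squareAddMul {n i d e : ℤ} :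
    (i, d, e) ∈ squareAddMul n ↔ 0 < d ∧ 0 < e ∧ i ^ 2 + d * e = n := by
  simp only [squareAddMul, Finset.mem_filter, Finset.mem_product, Finset.mem_Icc]
  constructor
  · rintro ⟨⟨_, ⟨_, _⟩, _, _⟩, h⟩
    exact ⟨by omega, by omega, h⟩
  · rintro ⟨hd, he, h⟩
    have h1 : d ≤ d * e := le_mul_of_one_le_right hd.le he
    have h2 : e ≤ d * e := le_mul_of_one_le_left he.le hd
    refine ⟨⟨⟨?_, ?_⟩, ⟨hd, ?_⟩, he, ?_⟩, h⟩ <;> nlinarith [sq_nonneg i, Int.le_self_sq i,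
      Int.le_self_sq (-i)]

theorem sum_squareAddMul_neg (n : ℤ) (f : ℤ → ℤ → ℤ → ℤ) :
    ∑ p ∈ squareAddMul n, f (-p.1) p.2.1 p.2.2 = ∑ p ∈ squareAddMul n, f p.1 p.2.1 p.2.2 := by
  refine Finset.sum_nbij' (fun p => (-p.1, p.2.1, p.2.2)) (fun p => (-p.1, p.2.1, p.2.2))
    ?_ ?_ ?_ ?_ ?_ <;> rintro ⟨i, d, e⟩ <;> simp [mem_squareAddMul]

theorem sum_squareAddMul_swap (n : ℤ) (f : ℤ → ℤ → ℤ → ℤ) :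
    ∑ p ∈ squareAddMul n, f p.1 p.2.2 p.2.1 = ∑ p ∈ squareAddMul n, f p.1 p.2.1 p.2.2 := by
  refine Finset.sum_nbij' (fun p => (p.1, p.2.2, p.2.1)) (fun p => (p.1, p.2.2, p.2.1))
    ?_ ?_ ?_ ?_ ?_ <;> rintro ⟨i, d, e⟩ <;> simp +contextual [mem_squareAddMul, mul_comm]

/-- Liouville's identity for a function odd in its first argument and even in the other two
taken jointly. -/
theorem liouville_identity (n : ℤ) (F : ℤ → ℤ → ℤ → ℤ)
    (hodd : ∀ x y z, F (-x) y z = -F x y z) (heven : ∀ x y z, F x (-y) (-z) = F x y z) :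
    2 * ∑ p ∈ squareAddMul n, F (p.2.2 - 2 * p.1) (p.1 + p.2.1) (2 * p.1 + 2 * p.2.1 - p.2.2)
      + ∑ p ∈ squareAddMul n with p.2.2 + 2 * p.1 = p.2.1,
          F (p.2.1 + p.2.2) p.1 (p.2.1 - p.2.2)
    = ∑ p ∈ squareAddMul n, F (p.2.1 + p.2.2) p.1 (p.2.1 - p.2.2)
      + 2 * ∑ p ∈ squareAddMul n with p.2.2 - 2 * p.1 = p.2.1,
          F (p.2.2 - 2 * p.1) (p.1 + p.2.1) (2 * p.1 + 2 * p.2.1 - p.2.2) := by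
  set G : ℤ × ℤ × ℤ → ℤ :=
    fun p => F (p.2.2 - 2 * p.1) (p.1 + p.2.1) (2 * p.1 + 2 * p.2.1 - p.2.2) with hG
  set H : ℤ × ℤ × ℤ → ℤ := fun p => F (p.2.1 + p.2.2) p.1 (p.2.1 - p.2.2) with hH
  have split (f g h : ℤ × ℤ × ℤ → ℤ) : ∑ p ∈ squareAddMul n, f p
      = ∑ p ∈ squareAddMul n with g p < h p, f p + ∑ p ∈ squareAddMul n with g p = h p, f p
        + ∑ p ∈ squareAddMul n with h p < g p, f p := by
    simp only [Finset.sum_filter, ← Finset.sum_add_distrib]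
    refine Finset.sum_congr rfl fun p _ => ?_
    rcases lt_trichotomy (g p) (h p) with hp | hp | hp
    · simp [hp, hp.ne, hp.not_gt]
    · simp [hp]
    · simp [hp, hp.ne', hp.not_gt]
  have cancel : ∑ p ∈ squareAddMul n with p.2.2 - 2 * p.1 < p.2.1, G p = 0 := by
    have : ∑ p ∈ squareAddMul n with p.2.2 - 2 * p.1 < p.2.1, G p
        = ∑ p ∈ squareAddMul n with p.2.2 - 2 * p.1 < p.2.1, -G p := by
      refine Finset.sum_nbij' (fun p => (p.2.2 - p.1, p.2.1 + 2 * p.1 - p.2.2, p.2.2))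
        (fun p => (p.2.2 - p.1, p.2.1 + 2 * p.1 - p.2.2, p.2.2)) ?_ ?_ ?_ ?_ ?_
      iterate 2
        rintro ⟨i, d, e⟩ h
        simp only [Finset.mem_filter, mem_squareAddMul] at h ⊢
        obtain ⟨⟨hd, he, h⟩, hlt⟩ := h
        exact ⟨⟨by linarith, he, by rw [← h]; ring⟩, by linarith⟩
      · rintro ⟨i, d, e⟩ h
        ext <;> simp
        ring
      · rintro ⟨i, d, e⟩ h
        ext <;> simp
        ring
      · rintro ⟨i, d, e⟩ h
        simp only [hG]
        rw [← hodd]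
        congr 1 <;> ring
    rw [Finset.sum_neg_distrib] at this
    linarith
  have shift : ∑ p ∈ squareAddMul n with p.2.1 < p.2.2 - 2 * p.1, G p
      = ∑ p ∈ squareAddMul n with p.2.1 < p.2.2 + 2 * p.1, H p := by
    refine Finset.sum_nbij' (fun p => (p.1 + p.2.1, p.2.1, p.2.2 - 2 * p.1 - p.2.1))
      (fun p => (p.1 - p.2.1, p.2.1, p.2.2 + 2 * p.1 - p.2.1)) ?_ ?_ ?_ ?_ ?_
    iterate 2
      rintro ⟨i, d, e⟩ h
      simp only [Finset.mem_filter, mem_squareAddMul] at h ⊢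
      obtain ⟨⟨hd, he, h⟩, hlt⟩ := h
      exact ⟨⟨hd, by linarith, by rw [← h]; ring⟩, by linarith⟩
    · rintro ⟨i, d, e⟩ h
      ext <;> simp
      ring
    · rintro ⟨i, d, e⟩ h
      ext <;> simp
      ring
    · rintro ⟨i, d, e⟩ h
      simp only [hG, hH]
      congr 1 <;> ring
  have reflect : ∑ p ∈ squareAddMul n with p.2.2 + 2 * p.1 < p.2.1, H p
      = ∑ p ∈ squareAddMul n with p.2.1 < p.2.2 + 2 * p.1, H p := by
    refine Finset.sum_nbij' (fun p => (-p.1, p.2.2, p.2.1)) (fun p => (-p.1, p.2.2, p.2.1))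
      ?_ ?_ ?_ ?_ ?_
    iterate 2
      rintro ⟨i, d, e⟩ h
      simp only [Finset.mem_filter, mem_squareAddMul] at h ⊢
      obtain ⟨⟨hd, he, h⟩, hlt⟩ := h
      exact ⟨⟨he, hd, by rw [← h]; ring⟩, by linarith⟩
    · simp
    · simp
    · rintro ⟨i, d, e⟩ h
      simp only [hH]
      rw [← heven]
      congr 1 <;> ring
  have hGsum := split G (fun p => p.2.2 - 2 * p.1) (fun p => p.2.1)
  have hHsum := split H (fun p => p.2.2 + 2 * p.1) (fun p => p.2.1)
  linarith

/-- The weight of a factorization `d * e` in Jacobi's four-square formula. -/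
def jacobiWeight (d e : ℤ) : ℤ :=
  if Odd d then (if Odd e then d else 3 * d) else 0

/-- A form odd in `x` and even in `(y, z)`, restricted by parity, whose Liouville identity
is the recurrence satisfied by Jacobi's divisor sum. -/
def jacobiForm (n x y z : ℤ) : ℤ :=
  if Even x ∧ Odd (y + n) then 16 * x * y ^ 2 - x ^ 3 + x * z ^ 2 - 4 * x * y * z else 0

theorem sum_jacobiForm (n : ℤ) :
    2 * ∑ p ∈ squareAddMul n,
        jacobiForm n (p.2.2 - 2 * p.1) (p.1 + p.2.1) (2 * p.1 + 2 * p.2.1 - p.2.2)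
      - ∑ p ∈ squareAddMul n, jacobiForm n (p.2.1 + p.2.2) p.1 (p.2.1 - p.2.2)
    = 8 * ∑ p ∈ squareAddMul n, jacobiWeight p.2.1 p.2.2 * (n - 5 * p.1 ^ 2) := by
  let K : ℤ → ℤ → ℤ → ℤ := fun i d e =>
    2 * jacobiForm n (e - 2 * i) (i + d) (2 * i + 2 * d - e) - jacobiForm n (d + e) i (d - e)
      - 8 * (jacobiWeight d e * (n - 5 * i ^ 2))
  have hK : ∑ p ∈ squareAddMul n, K p.1 p.2.1 p.2.2 = 0 := by
    have h1 := sum_squareAddMul_neg n K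
    have h2 := sum_squareAddMul_swap n K
    have h3 := sum_squareAddMul_swap n (fun i d e => K (-i) d e)
    have h4 : ∑ p ∈ squareAddMul n, (K p.1 p.2.1 p.2.2 + K (-p.1) p.2.1 p.2.2
        + K p.1 p.2.2 p.2.1 + K (-p.1) p.2.2 p.2.1) = 0 := by
      refine Finset.sum_eq_zero ?_
      rintro ⟨i, d, e⟩ h
      obtain ⟨-, -, h⟩ := mem_squareAddMul.1 h
      subst h
      rcases Int.even_or_odd i with hi | hi <;> rcases Int.even_or_odd d with hd | hd <;>
        rcases Int.even_or_odd e with he | he <;>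
        simp only [K, jacobiForm, jacobiWeight, ← Int.not_even_iff_odd] at * <;>
        simp [hi, hd, he, Int.even_add, Int.even_sub, Int.even_mul, Int.even_pow] <;> ring
    simp only [Finset.sum_add_distrib] at h4
    linarith
  simp only [K, Finset.sum_sub_distrib, ← Finset.mul_sum] at hK
  linarith

theorem sum_range_three_mul_sub_sq (s : ℤ) (m : ℕ) :
    ∑ j ∈ Finset.range m, (3 * (s - 2 * j - 1) ^ 2 - s ^ 2)
      = m * (2 * s ^ 2 - 6 * s * m + 4 * m ^ 2 - 1) := by
  induction m with
  | zero => simp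
  | succ m ih => rw [Finset.sum_range_succ, ih]; push_cast; ring

theorem sum_jacobiForm_boundary (s : ℕ) :
    ∑ p ∈ squareAddMul ((s : ℤ) ^ 2) with p.2.2 + 2 * p.1 = p.2.1,
      jacobiForm ((s : ℤ) ^ 2) (p.2.1 + p.2.2) p.1 (p.2.1 - p.2.2) = -8 * (s : ℤ) ^ 2 := by
  have h : ∑ j ∈ Finset.range s, 8 * (s : ℤ) * (3 * ((s : ℤ) - 2 * j - 1) ^ 2 - (s : ℤ) ^ 2)
      = -8 * (s : ℤ) ^ 2 := by
    rw [← Finset.mul_sum, sum_range_three_mul_sub_sq]; ring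
  rw [← h, eq_comm]
  have key (j : ℕ) : jacobiForm ((s : ℤ) ^ 2) ((2 * j + 1 + 2 * ((s : ℤ) - 2 * j - 1))
      + (2 * j + 1)) ((s : ℤ) - 2 * j - 1) (2 * j + 1 + 2 * ((s : ℤ) - 2 * j - 1) - (2 * j + 1))
      = 8 * (s : ℤ) * (3 * ((s : ℤ) - 2 * j - 1) ^ 2 - (s : ℤ) ^ 2) := by
    rw [jacobiForm, if_pos]
    · ring
    · refine ⟨⟨s, by ring⟩, ?_⟩
      have : ¬ (Odd s ↔ Even s) := by rw [← Nat.not_even_iff_odd]; tauto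
      simpa [← Int.not_even_iff_odd, Int.even_add, Int.even_sub, Int.even_pow] using this
  refine Finset.sum_of_injOn (fun j => ((s : ℤ) - 2 * j - 1,
    2 * j + 1 + 2 * ((s : ℤ) - 2 * j - 1), (2 * j + 1 : ℤ))) ?_ ?_ ?_ ?_
  · intro a _ b _ hab
    simpa using congrArg (fun p => p.2.2) hab
  · intro j hj
    have : j < s := by simpa using hj
    simp only [Finset.coe_filter, Set.mem_ofPred_eq, mem_squareAddMul]
    exact ⟨⟨by omega, by omega, by ring⟩, trivial⟩
  · rintro ⟨i, d, e⟩ hp hne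
    simp only [Finset.mem_filter, mem_squareAddMul] at hp
    obtain ⟨⟨hd, he, hn⟩, rfl⟩ := hp
    have hs : i + e = s := by
      have : (i + e) ^ 2 = (s : ℤ) ^ 2 := by rw [← hn]; ring
      rcases sq_eq_sq_iff_eq_or_eq_neg.1 this with h | h <;> omega
    rw [jacobiForm, if_neg]
    rintro ⟨-, hodd⟩
    have heo : Odd e := by
      rw [← hs] at hodd
      simp only [← Int.not_even_iff_odd, Int.even_add, Int.even_pow] at hodd ⊢
      tauto
    obtain ⟨k, rfl⟩ := heo
    lift k to ℕ using by omega
    refine hne ⟨k, ?_, ?_⟩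
    · simp only [Finset.coe_range, Set.mem_Iio]; omega
    · have : i = (s : ℤ) - 2 * k - 1 := by omega
      simp [this]
  · intro j _
    exact (key j).symm

/-- Jacobi's divisor sum, extended to all integers with value `1` at `0`. -/
def fourSquareDivisorSum (m : ℤ) : ℤ :=
  if m = 0 then 1 else 8 * ∑ p ∈ m.toNat.divisorsAntidiagonal, jacobiWeight p.1 p.2

theorem sum_squareAddMul_eq (n : ℤ) (f : ℤ → ℤ → ℤ → ℤ) :
    ∑ p ∈ squareAddMul n, f p.1 p.2.1 p.2.2
      = ∑ k ∈ Finset.Icc (-n) n, ∑ p ∈ (n - k ^ 2).toNat.divisorsAntidiagonal, f k p.1 p.2 := by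
  rw [Finset.sum_sigma', eq_comm]
  refine Finset.sum_bij' (fun q _ => (q.1, (q.2.1 : ℤ), (q.2.2 : ℤ)))
    (fun p _ => ⟨p.1, (p.2.1.toNat, p.2.2.toNat)⟩) ?_ ?_ ?_ ?_ ?_
  · rintro ⟨k, d, e⟩ h
    simp only [Finset.mem_sigma, Nat.mem_divisorsAntidiagonal] at h
    obtain ⟨-, h, h0⟩ := h
    have h1 : d ≠ 0 := by rintro rfl; simp at h; omega
    have h2 : e ≠ 0 := by rintro rfl; simp at h; omega
    refine mem_squareAddMul.2 ⟨by simp; omega, by simp; omega, ?_⟩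
    have : ((d * e : ℕ) : ℤ) = n - k ^ 2 := by rw [h]; omega
    push_cast at this
    simp only
    linarith
  · rintro ⟨i, d, e⟩ h
    have h' := h
    simp only [squareAddMul, Finset.mem_filter, Finset.mem_product] at h'
    obtain ⟨hd, he, h⟩ := mem_squareAddMul.1 h
    lift d to ℕ using hd.le
    lift e to ℕ using he.le
    simp only [Finset.mem_sigma, Nat.mem_divisorsAntidiagonal]
    have hde : n - i ^ 2 = ((d * e : ℕ) : ℤ) := by push_cast; linarith
    refine ⟨h'.1.1, ?_, ?_⟩
    · rw [hde, Int.toNat_natCast, Int.toNat_natCast, Int.toNat_natCast]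
    · have : 0 < d * e := Nat.mul_pos (by omega) (by omega)
      omega
  · rintro ⟨k, d, e⟩ h
    simp
  · rintro ⟨i, d, e⟩ h
    obtain ⟨hd, he, h⟩ := mem_squareAddMul.1 h
    simp [hd.le, he.le]
  · simp

theorem sum_mul_fourSquareDivisorSum (n : ℕ) (hn : 0 < n) :
    ∑ k ∈ Finset.Icc (-(n : ℤ)) n, ((n : ℤ) - 5 * k ^ 2) * fourSquareDivisorSum (n - k ^ 2) = 0 := by
  have hL := liouville_identity n (jacobiForm n)
    (by
      intro x y z
      simp only [jacobiForm, even_neg]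
      split_ifs <;> ring)
    (by
      intro x y z
      have : Odd (-y + n : ℤ) ↔ Odd (y + n : ℤ) := by
        simp [← Int.not_even_iff_odd, Int.even_add]
      simp only [jacobiForm, this]
      split_ifs <;> ring)
  have hzero : ∑ p ∈ squareAddMul (n : ℤ) with p.2.2 - 2 * p.1 = p.2.1,
      jacobiForm n (p.2.2 - 2 * p.1) (p.1 + p.2.1) (2 * p.1 + 2 * p.2.1 - p.2.2) = 0 := by
    refine Finset.sum_eq_zero ?_
    rintro ⟨i, d, e⟩ h
    simp only [Finset.mem_filter, mem_squareAddMul] at h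
    obtain ⟨⟨-, -, h⟩, hd⟩ := h
    rw [jacobiForm, if_neg]
    rintro ⟨-, hodd⟩
    have hsq : (i + d) ^ 2 = (n : ℤ) := by rw [← h, ← hd]; ring
    rw [← hsq] at hodd
    simp [← Int.not_even_iff_odd, Int.even_add, Int.even_pow] at hodd
  have hJ := sum_jacobiForm n
  rw [hzero] at hL
  have hterm (k : ℤ) : ((n : ℤ) - 5 * k ^ 2) * fourSquareDivisorSum (n - k ^ 2)
      = (if k ^ 2 = n then -4 * (n : ℤ) else 0)
        + 8 * ∑ p ∈ ((n : ℤ) - k ^ 2).toNat.divisorsAntidiagonal,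
          jacobiWeight p.1 p.2 * (n - 5 * k ^ 2) := by
    rw [fourSquareDivisorSum, ← Finset.sum_mul]
    by_cases hk : k ^ 2 = n
    · simp [hk]; ring
    · rw [if_neg (by omega), if_neg hk]; ring
  have hS := sum_squareAddMul_eq n (fun k d e => jacobiWeight d e * (n - 5 * k ^ 2))
  simp only [hterm, Finset.sum_add_distrib, ← Finset.mul_sum]
  rw [← hS, ← hJ]
  by_cases hsq : ∃ s : ℕ, s ^ 2 = n
  · obtain ⟨s, rfl⟩ := hsq
    have hs : 0 < s := Nat.pos_of_ne_zero (by rintro rfl; simp at hn)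
    have hB := sum_jacobiForm_boundary s
    push_cast at hL ⊢
    rw [hB] at hL
    have hcount : ∑ k ∈ Finset.Icc (-(s : ℤ) ^ 2) ((s : ℤ) ^ 2),
        (if k ^ 2 = (s : ℤ) ^ 2 then -4 * (s : ℤ) ^ 2 else 0) = -8 * (s : ℤ) ^ 2 := by
      rw [← Finset.sum_filter]
      have : (Finset.Icc (-(s : ℤ) ^ 2) ((s : ℤ) ^ 2)).filter (fun k => k ^ 2 = (s : ℤ) ^ 2)
          = {(s : ℤ), -(s : ℤ)} := by
        ext k
        simp only [Finset.mem_filter, Finset.mem_Icc, Finset.mem_insert, Finset.mem_singleton,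
          sq_eq_sq_iff_eq_or_eq_neg, and_iff_right_iff_imp]
        rintro (rfl | rfl) <;> constructor <;> nlinarith
      rw [this, Finset.sum_pair (by omega)]
      ring
    rw [hcount]
    linarith
  · have hne (k : ℤ) : k ^ 2 ≠ n := by
      intro h
      refine hsq ⟨k.natAbs, ?_⟩
      zify
      simpa using h
    have hB : (squareAddMul (n : ℤ)).filter (fun p => p.2.2 + 2 * p.1 = p.2.1) = ∅ := by
      refine Finset.filter_eq_empty_iff.2 ?_
      rintro ⟨i, d, e⟩ h hd
      obtain ⟨-, -, h⟩ := mem_squareAddMul.1 h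
      simp only at hd
      exact hne (i + e) (by rw [← h, ← hd]; ring)
    rw [hB, Finset.sum_empty] at hL
    simp only [hne, if_false, Finset.sum_const_zero]
    linarith

/-- The representations of an integer as an ordered sum of `m` squares. -/
noncomputable def sumSquaresReps (m : ℕ) (n : ℤ) : Finset (Fin m → ℤ) :=
  (Fintype.piFinset fun _ => Finset.Icc (-n) n).filter fun v => ∑ j, v j ^ 2 = n

theorem mem_sumSquaresReps {m : ℕ} {n : ℤ} {v : Fin m → ℤ} :
    v ∈ sumSquaresReps m n ↔ ∑ j, v j ^ 2 = n := by
  simp only [sumSquaresReps, Finset.mem_filter, Fintype.mem_piFinset, Finset.mem_Icc,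
    and_iff_right_iff_imp]
  rintro h j
  have := Finset.single_le_sum (f := fun j => v j ^ 2) (fun j _ => sq_nonneg (v j))
    (Finset.mem_univ j)
  simp only [h] at this
  constructor <;> linarith [Int.le_self_sq (v j), Int.le_self_sq (-v j), neg_sq (v j)]

theorem sum_sumSquaresReps_apply_sq (m : ℕ) (n : ℤ) (j : Fin (m + 1)) :
    ∑ v ∈ sumSquaresReps (m + 1) n, v j ^ 2 = ∑ v ∈ sumSquaresReps (m + 1) n, v 0 ^ 2 := by
  refine Finset.sum_equiv ((Equiv.swap 0 j).arrowCongr (Equiv.refl ℤ)) ?_ ?_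
  · intro v
    simp only [mem_sumSquaresReps, Equiv.arrowCongr_apply, Equiv.coe_refl, Function.comp_apply,
      id_eq]
    rw [Equiv.sum_comp (Equiv.swap 0 j).symm (fun i => v i ^ 2)]
  · simp

theorem sum_card_sumSquaresReps (m : ℕ) (n : ℤ) :
    ∑ k ∈ Finset.Icc (-n) n,
      (n - (m + 1) * k ^ 2) * ((sumSquaresReps m (n - k ^ 2)).card : ℤ) = 0 := by
  have h0 : ∑ v ∈ sumSquaresReps (m + 1) n, (n - (m + 1) * v 0 ^ 2) = 0 := by
    have : ∑ v ∈ sumSquaresReps (m + 1) n, n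
        = ∑ v ∈ sumSquaresReps (m + 1) n, ∑ j, v j ^ 2 :=
      Finset.sum_congr rfl fun v hv => (mem_sumSquaresReps.1 hv).symm
    rw [Finset.sum_sub_distrib, this, Finset.sum_comm]
    simp only [sum_sumSquaresReps_apply_sq]
    simp [← Finset.mul_sum]
  rw [← h0]
  have : ∀ k ∈ Finset.Icc (-n) n,
      (n - (m + 1) * k ^ 2) * ((sumSquaresReps m (n - k ^ 2)).card : ℤ)
        = ∑ _v ∈ sumSquaresReps m (n - k ^ 2), (n - (m + 1) * k ^ 2) := by
    intro k _
    rw [Finset.sum_const, nsmul_eq_mul, mul_comm]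
  rw [Finset.sum_congr rfl this, Finset.sum_sigma']
  refine Finset.sum_bij' (fun q _ => (Fin.cons q.1 q.2 : Fin (m + 1) → ℤ))
    (fun v _ => ⟨v 0, Fin.tail v⟩) ?_ ?_ ?_ ?_ ?_
  · rintro ⟨k, v⟩ h
    simp only [Finset.mem_sigma, mem_sumSquaresReps] at h
    simp only [mem_sumSquaresReps, Fin.sum_univ_succ, Fin.cons_zero, Fin.cons_succ]
    linarith [h.2]
  · intro v h
    have h' := h
    simp only [sumSquaresReps, Finset.mem_filter, Fintype.mem_piFinset] at h'
    simp only [mem_sumSquaresReps, Fin.sum_univ_succ] at h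
    simp only [Finset.mem_sigma, mem_sumSquaresReps, Fin.tail]
    exact ⟨h'.1 0, by linarith⟩
  · rintro ⟨k, v⟩ h
    simp
  · intro v h
    simp
  · rintro ⟨k, v⟩ h
    simp

theorem card_sumSquaresReps_four (n : ℕ) : ((sumSquaresReps 4 n).card : ℤ) = fourSquareDivisorSum n := by
  induction n using Nat.strong_induction_on with
  | _ n ih =>
    rcases Nat.eq_zero_or_pos n with rfl | hn
    · have : sumSquaresReps 4 0 = {0} := by
        ext v
        simp [mem_sumSquaresReps, Finset.sum_eq_zero_iff_of_nonneg, sq_nonneg, funext_iff]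
      simp [this, fourSquareDivisorSum]
    · have h1 := sum_card_sumSquaresReps 4 n
      have h2 := sum_mul_fourSquareDivisorSum n hn
      norm_num only at h1
      rw [← h2, ← sub_eq_zero, ← Finset.sum_sub_distrib, Finset.sum_eq_single 0] at h1
      · simp only [ne_eq, OfNat.ofNat_ne_zero, not_false_eq_true, zero_pow, mul_zero, sub_zero,
          ← mul_sub] at h1
        rcases mul_eq_zero.1 h1 with h | h
        · omega
        · linarith
      · intro k _ hk
        have hk2 : 0 < k ^ 2 := by positivity
        rcases lt_or_ge (n : ℤ) (k ^ 2) with hlt | hle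
        · have hneg : (n : ℤ) - k ^ 2 < 0 := by linarith
          have hempty : sumSquaresReps 4 ((n : ℤ) - k ^ 2) = ∅ := by
            refine Finset.eq_empty_of_forall_notMem fun v hv => ?_
            have := mem_sumSquaresReps.1 hv
            have : 0 ≤ ∑ j, v j ^ 2 := Finset.sum_nonneg fun j _ => sq_nonneg _
            linarith
          simp [hempty, fourSquareDivisorSum, hneg.ne, Int.toNat_of_nonpos hneg.le]
        · obtain ⟨m, hm⟩ := Int.eq_ofNat_of_zero_le (sub_nonneg.2 hle)
          rw [hm, ih m (by omega), sub_self]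
      · intro h
        simp at h

theorem fourSquareReps_eq_fourSquareDivisorSum (n : ℕ) : (fourSquareReps n : ℤ) = fourSquareDivisorSum n := by
  rw [← card_sumSquaresReps_four, fourSquareReps, ← Set.ncard_coe_finset]
  congr 2
  ext v
  simp [mem_sumSquaresReps, Fin.sum_univ_four]

theorem jacobi_four_square (n : ℕ) (hn : 0 < n) :
    (Odd n → fourSquareReps n = 8 * ∑ d ∈ n.divisors, d) ∧
    (Even n → fourSquareReps n = 24 * ∑ d ∈ n.divisors.filter (fun d => ¬ 2 ∣ d), d) := by
  have h := fourSquareReps_eq_fourSquareDivisorSum n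
  rw [fourSquareDivisorSum, if_neg (by omega), Int.toNat_natCast] at h
  rw [Nat.sum_divisorsAntidiagonal (fun d e => jacobiWeight d e)] at h
  constructor
  · intro hodd
    zify
    rw [h]
    congr 1
    refine Finset.sum_congr rfl fun d hd => ?_
    have hdn := Nat.dvd_of_mem_divisors hd
    have h1 : Odd (d : ℤ) := (Int.odd_coe_nat d).2 (hodd.of_dvd_nat hdn)
    have h2 : Odd ((n / d : ℕ) : ℤ) :=
      (Int.odd_coe_nat _).2 (hodd.of_dvd_nat (Nat.div_dvd_of_dvd hdn))
    rw [jacobiWeight, if_pos h1, if_pos h2]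
  · intro heven
    zify
    rw [h, show (24 : ℤ) = 8 * 3 by norm_num, mul_assoc, Finset.mul_sum _ _ (3 : ℤ),
      Finset.sum_filter]
    congr 1
    refine Finset.sum_congr rfl fun d hd => ?_
    have hdn := Nat.dvd_of_mem_divisors hd
    have hodd_iff : Odd (d : ℤ) ↔ ¬ (2 : ℤ) ∣ d := by
      rw [← even_iff_two_dvd, Int.not_even_iff_odd]
    by_cases h1 : Odd (d : ℤ)
    · rw [jacobiWeight, if_pos h1, if_pos (hodd_iff.1 h1), if_neg]
      intro h2
      have := ((Int.odd_coe_nat d).1 h1).mul ((Int.odd_coe_nat _).1 h2)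
      rw [Nat.mul_div_cancel' hdn] at this
      exact Nat.not_even_iff_odd.2 this heven
    · rw [jacobiWeight, if_neg h1, if_neg (mt hodd_iff.2 h1)]
end
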